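/- arXiv:2006.10307 — 2 statements merged into one kernel-verified Lean document; each statement's English description precedes it below -/
import Mathlib

section
/- Let P be a fine zonotopal tiling of Z(V) for the lifted configuration of a point set A ⊂ ℝ^d affinely spanning ℝ^d, and let 0 ≤ k ≤ n−d−1. Then the multiset of simplices T^(k) := {conv({a_b : b ∈ B}) : Π_{I,B} ∈ P, |I| = k} covers the region ch_k(A) exactly C(k+d, d) times; that is, for almost every x ∈ ch_k(A), the number of tiles Π_{I,B} ∈ P with |I| = k and x ∈ conv({a_b : b ∈ B}) equals C(k+d, d). -/
open Finset

/-- The parallelepiped tile `Π_{I,B} = ∑_{i∈I} v_i + ∑_{b∈B} [0, v_b]`. -/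
def tileSet {n : ℕ} {E : Type*} [AddCommGroup E] [Module ℝ E]
    (v : Fin n → E) (I B : Finset (Fin n)) : Set E :=
  {z | ∃ α : Fin n → ℝ, (∀ b ∈ B, α b ∈ Set.Icc (0 : ℝ) 1) ∧
    z = (∑ i ∈ I, v i) + ∑ b ∈ B, α b • v b}

/-- A fine zonotopal tiling of the zonotope `Z(V) = ∑_{i=1}^n [0, v_i]`: a collection of
parallelepiped tiles `Π_{I,B}` with `I ∩ B = ∅`, `|B| = d+1`, `{v_b}_{b∈B}` linearly
independent, covering `Z(V)` and with pairwise disjoint interiors. -/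
structure IsFineZonotopalTiling {n : ℕ} {E : Type*} [AddCommGroup E] [Module ℝ E]
    [TopologicalSpace E] (d : ℕ) (v : Fin n → E)
    (P : Finset (Finset (Fin n) × Finset (Fin n))) : Prop where
  disj : ∀ p ∈ P, Disjoint p.1 p.2
  cardB : ∀ p ∈ P, p.2.card = d + 1
  indep : ∀ p ∈ P, LinearIndependent ℝ (fun b : p.2 => v ↑b)
  cover : (⋃ p ∈ P, tileSet v p.1 p.2) = tileSet v ∅ Finset.univ
  intdisj : ∀ p ∈ P, ∀ q ∈ P, p ≠ q →
    interior (tileSet v p.1 p.2) ∩ interior (tileSet v q.1 q.2) = ∅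

open MeasureTheory ProbabilityTheory

/-- Cutting a convex set by the hyperplane `α i = 1` is additive for the indicator of
nonemptiness. -/
lemma indicator_nonempty_cut {ι : Type*} (i : ι) {K : Set (ι → ℝ)} (hK : Convex ℝ K) :
    (open Classical in if (K ∩ {α | α i ≤ 1}).Nonempty then (1 : ℤ) else 0) =
      (open Classical in if K.Nonempty then (1 : ℤ) else 0)
      - (open Classical in if (K ∩ {α | 1 ≤ α i}).Nonempty then (1 : ℤ) else 0)
      + (open Classical in if (K ∩ {α | 1 ≤ α i} ∩ {α | α i ≤ 1}).Nonempty then (1 : ℤ) else 0) := by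
  classical
  by_cases h1 : (K ∩ {α | α i ≤ 1}).Nonempty
  · have h0 : K.Nonempty := h1.mono Set.inter_subset_left
    by_cases h2 : (K ∩ {α | 1 ≤ α i}).Nonempty
    · have h3 : (K ∩ {α | 1 ≤ α i} ∩ {α | α i ≤ 1}).Nonempty := by
        obtain ⟨x, hx, hx1⟩ := h1
        obtain ⟨y, hy, hy1⟩ := h2
        have hc : ContinuousOn (fun α : ι → ℝ => α i) K := (continuous_apply i).continuousOn
        obtain ⟨w, hw, hw1⟩ := hK.isPreconnected.intermediate_value hx hy hc ⟨hx1, hy1⟩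
        exact ⟨w, ⟨hw, hw1.ge⟩, hw1.le⟩
      simp [h0, h1, h2, h3]
    · have h3 : ¬ (K ∩ {α | 1 ≤ α i} ∩ {α | α i ≤ 1}).Nonempty :=
        fun h => h2 (h.mono Set.inter_subset_left)
      simp [h0, h1, h2, h3]
  · have h3 : ¬ (K ∩ {α | 1 ≤ α i} ∩ {α | α i ≤ 1}).Nonempty :=
      fun ⟨x, hx, hx1⟩ => h1 ⟨x, hx.1, hx1⟩
    have h2 : (K ∩ {α | 1 ≤ α i}).Nonempty ↔ K.Nonempty := by
      refine ⟨fun h => h.mono Set.inter_subset_left, fun ⟨x, hx⟩ => ⟨x, hx, ?_⟩⟩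
      by_contra h
      have h' : x i < 1 := lt_of_not_ge h
      exact h1 ⟨x, hx, h'.le⟩
    simp [h1, h2, h3]

lemma convex_setOf_one_le {ι : Type*} (i : ι) : Convex ℝ {α : ι → ℝ | 1 ≤ α i} :=
  convex_halfSpace_ge (LinearMap.proj i : (ι → ℝ) →ₗ[ℝ] ℝ).isLinear 1

lemma convex_setOf_le_one {ι : Type*} (i : ι) : Convex ℝ {α : ι → ℝ | α i ≤ 1} :=
  convex_halfSpace_le (LinearMap.proj i : (ι → ℝ) →ₗ[ℝ] ℝ).isLinear 1

open Classical in
/-- Imposing upper bounds `α i ≤ 1` on a convex set expands, for the indicator of nonemptiness,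
into a signed sum over lower bounds `1 ≤ α i` and equalities `α i = 1`. -/
lemma indicator_nonempty_expansion {ι : Type*} (s : Finset ι) {K : Set (ι → ℝ)}
    (hK : Convex ℝ K) :
    (if (K ∩ {α | ∀ i ∈ s, α i ≤ 1}).Nonempty then (1 : ℤ) else 0) =
      ∑ S ∈ s.powerset, ∑ T ∈ S.powerset, (-1) ^ (S.card + T.card) *
        (if (K ∩ {α | ∀ i ∈ S, 1 ≤ α i} ∩ {α | ∀ i ∈ T, α i ≤ 1}).Nonempty then (1 : ℤ) else 0) := by
  induction s using Finset.induction_on generalizing K with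
  | empty => simp
  | insert i s hi ih =>
    have hK1 := hK.inter (convex_setOf_one_le i)
    have hK2 := hK1.inter (convex_setOf_le_one i)
    have hs : Convex ℝ {α : ι → ℝ | ∀ i ∈ s, α i ≤ 1} := by
      have : {α : ι → ℝ | ∀ i ∈ s, α i ≤ 1} = ⋂ i ∈ s, {α | α i ≤ 1} := by ext; simp
      rw [this]
      exact convex_iInter₂ fun i _ => convex_setOf_le_one i
    have e0 : K ∩ {α | ∀ j ∈ insert i s, α j ≤ 1} =
        (K ∩ {α | ∀ j ∈ s, α j ≤ 1}) ∩ {α | α i ≤ 1} := by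
      ext α; simp; tauto
    have e1 : (K ∩ {α | ∀ j ∈ s, α j ≤ 1}) ∩ {α | 1 ≤ α i} =
        (K ∩ {α | 1 ≤ α i}) ∩ {α | ∀ j ∈ s, α j ≤ 1} := by
      ext α; simp; tauto
    have e2 : (K ∩ {α | 1 ≤ α i}) ∩ {α | ∀ j ∈ s, α j ≤ 1} ∩ {α | α i ≤ 1} =
        (K ∩ {α | 1 ≤ α i} ∩ {α | α i ≤ 1}) ∩ {α | ∀ j ∈ s, α j ≤ 1} := by
      ext α; simp; tauto
    rw [e0, indicator_nonempty_cut i (hK.inter hs), e1, e2, ih hK, ih hK1, ih hK2,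
      Finset.sum_powerset_insert hi, sub_add, sub_eq_add_neg, neg_sub, ← Finset.sum_sub_distrib]
    congr 1
    refine Finset.sum_congr rfl fun S hS => ?_
    have hiS : i ∉ S := fun h => hi (Finset.mem_powerset.1 hS h)
    rw [Finset.sum_powerset_insert hiS, ← Finset.sum_sub_distrib, ← Finset.sum_add_distrib]
    refine Finset.sum_congr rfl fun T hT => ?_
    have hiT : i ∉ T := fun h => hiS (Finset.mem_powerset.1 hT h)
    have f1 : K ∩ {α | ∀ j ∈ insert i S, 1 ≤ α j} ∩ {α | ∀ j ∈ T, α j ≤ 1} =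
        K ∩ {α | 1 ≤ α i} ∩ {α | ∀ j ∈ S, 1 ≤ α j} ∩ {α | ∀ j ∈ T, α j ≤ 1} := by
      ext α; simp; tauto
    have f2 : K ∩ {α | ∀ j ∈ insert i S, 1 ≤ α j} ∩ {α | ∀ j ∈ insert i T, α j ≤ 1} =
        K ∩ {α | 1 ≤ α i} ∩ {α | α i ≤ 1} ∩ {α | ∀ j ∈ S, 1 ≤ α j} ∩
          {α | ∀ j ∈ T, α j ≤ 1} := by
      ext α; simp; tauto
    rw [f1, f2, Finset.card_insert_of_notMem hiS, Finset.card_insert_of_notMem hiT]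
    ring

/-- The convex hull of a finite indexed family, through coefficients on the index set. -/
lemma mem_convexHull_image_finset {ι E : Type*} [AddCommGroup E] [Module ℝ E] (a : ι → E)
    (W : Finset ι) (y : E) :
    y ∈ convexHull ℝ (a '' ↑W) ↔
      ∃ α : ι → ℝ, (∀ i ∈ W, 0 ≤ α i) ∧ ∑ i ∈ W, α i = 1 ∧ ∑ i ∈ W, α i • a i = y := by
  classical
  constructor
  · have hc : Convex ℝ {y : E | ∃ α : ι → ℝ, (∀ i ∈ W, 0 ≤ α i) ∧ ∑ i ∈ W, α i = 1 ∧
        ∑ i ∈ W, α i • a i = y} := by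
      rintro _ ⟨α, h1, h2, rfl⟩ _ ⟨β, g1, g2, rfl⟩ s t hs ht hst
      refine ⟨fun i => s * α i + t * β i, fun i hi => ?_, ?_, ?_⟩
      · have := h1 i hi
        have := g1 i hi
        positivity
      · rw [Finset.sum_add_distrib, ← Finset.mul_sum, ← Finset.mul_sum, h2, g2, mul_one, mul_one,
          hst]
      · simp only [add_smul, mul_smul, Finset.sum_add_distrib, Finset.smul_sum]
    refine fun h => convexHull_min ?_ hc h
    rintro _ ⟨i, hi, rfl⟩
    refine ⟨Pi.single i 1, fun j _ => ?_, ?_, ?_⟩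
    · by_cases h : j = i
      · subst h; simp
      · simp [h]
    · simpa [Finset.sum_pi_single] using hi
    · rw [Finset.sum_eq_single i] <;> simp_all
  · rintro ⟨α, h1, h2, rfl⟩
    exact (convex_convexHull ℝ _).sum_mem h1 h2
      fun i hi => subset_convexHull ℝ _ ⟨i, hi, rfl⟩

lemma sum_snoc_one {n d : ℕ} (a : Fin n → Fin d → ℝ) (W : Finset (Fin n)) (α : Fin n → ℝ) :
    ∑ i ∈ W, α i • (Fin.snoc (a i) 1 : Fin (d + 1) → ℝ) =
      Fin.snoc (∑ i ∈ W, α i • a i) (∑ i ∈ W, α i) := by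
  funext j
  refine Fin.lastCases ?_ (fun j => ?_) j
  · simp [Finset.sum_apply]
  · simp [Finset.sum_apply]

lemma snoc_add_snoc {d : ℕ} (y y' : Fin d → ℝ) (t t' : ℝ) :
    (Fin.snoc y t + Fin.snoc y' t' : Fin (d + 1) → ℝ) = Fin.snoc (y + y') (t + t') := by
  funext j
  refine Fin.lastCases ?_ (fun j => ?_) j <;> simp

/-- The horizontal slice at height `t` of a translated simplicial cone is a translated dilate of
a simplex. -/
lemma slice_cone {n d : ℕ} (a : Fin n → Fin d → ℝ) (I B S T : Finset (Fin n)) (hSB : S ⊆ B)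
    (hTS : T ⊆ S) (y : Fin d → ℝ) (t : ℝ) (ht : t ≠ (#I + #S : ℕ)) :
    (∃ α : Fin n → ℝ, (∀ i ∈ B, 0 ≤ α i) ∧ (∀ i ∈ S, 1 ≤ α i) ∧ (∀ i ∈ T, α i ≤ 1) ∧
      (Fin.snoc y t : Fin (d + 1) → ℝ) = ∑ i ∈ I, (Fin.snoc (a i) 1 : Fin (d + 1) → ℝ) +
        ∑ b ∈ B, α b • (Fin.snoc (a b) 1 : Fin (d + 1) → ℝ)) ↔
    ((#I + #S : ℕ) : ℝ) < t ∧ (t - (#I + #S : ℕ))⁻¹ • (y - (∑ i ∈ I, a i + ∑ i ∈ S, a i)) ∈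
      convexHull ℝ (a '' ↑(B \ T)) := by
  classical
  have hI := sum_snoc_one a I (fun _ => 1)
  simp only [one_smul] at hI
  simp only [sum_snoc_one, hI, snoc_add_snoc, Fin.snoc_inj, Finset.sum_const, nsmul_eq_mul,
    mul_one]
  have hSsum : ∀ f : Fin n → ℝ, ∑ i ∈ B, (if i ∈ S then f i else 0) = ∑ i ∈ S, f i := fun f => by
    rw [← Finset.sum_filter, Finset.filter_mem_eq_inter, Finset.inter_eq_right.2 hSB]
  have hSsum' : ∀ f : Fin n → (Fin d → ℝ), ∑ i ∈ B, (if i ∈ S then f i else 0) = ∑ i ∈ S, f i :=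
    fun f => by
    rw [← Finset.sum_filter, Finset.filter_mem_eq_inter, Finset.inter_eq_right.2 hSB]
  have hTB := hTS.trans hSB
  rw [mem_convexHull_image_finset]
  constructor
  · rintro ⟨α, h0, h1, h2, hy, ht'⟩
    set β : Fin n → ℝ := fun i => α i - if i ∈ S then 1 else 0 with hβ
    have hβT : ∀ i ∈ T, β i = 0 := fun i hi => by
      have := h1 i (hTS hi)
      have := h2 i hi
      simp only [hβ, if_pos (hTS hi)]; linarith
    have hβ0 : ∀ i ∈ B, 0 ≤ β i := fun i hi => by
      by_cases h : i ∈ S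
      · have := h1 i h
        simp only [hβ, if_pos h]; linarith
      · simpa [hβ, h] using h0 i hi
    have hs1 : ∑ i ∈ B \ T, β i = t - (#I + #S : ℕ) := by
      rw [Finset.sum_sdiff_eq_sub hTB, Finset.sum_eq_zero hβT, Finset.sum_sub_distrib, hSsum, ht']
      simp
    have hs2 : ∑ i ∈ B \ T, β i • a i = y - (∑ i ∈ I, a i + ∑ i ∈ S, a i) := by
      rw [Finset.sum_sdiff_eq_sub hTB, Finset.sum_eq_zero (s := T) fun i hi => by rw [hβT i hi, zero_smul]]
      simp only [hβ, sub_smul, Finset.sum_sub_distrib, ite_smul, one_smul, zero_smul, hSsum', hy]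
      abel
    have hpos : 0 < t - (#I + #S : ℕ) := lt_of_le_of_ne
      (hs1 ▸ Finset.sum_nonneg fun i hi => hβ0 i (Finset.mem_sdiff.1 hi).1) (sub_ne_zero.2 ht).symm
    refine ⟨sub_pos.1 hpos, fun i => (t - (#I + #S : ℕ))⁻¹ * β i, fun i hi => ?_, ?_, ?_⟩
    · exact mul_nonneg (inv_nonneg.2 hpos.le) (hβ0 i (Finset.mem_sdiff.1 hi).1)
    · rw [← Finset.mul_sum, hs1, inv_mul_cancel₀ hpos.ne']
    · simp only [mul_smul]
      rw [← Finset.smul_sum, hs2]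
  · rintro ⟨hlt, γ, h0, h1, h2⟩
    have hpos : 0 < t - (#I + #S : ℕ) := sub_pos.2 hlt
    set s := t - (#I + #S : ℕ) with hs
    have hyy : ∑ i ∈ B \ T, (s * γ i) • a i = y - (∑ i ∈ I, a i + ∑ i ∈ S, a i) := by
      simp only [mul_smul]
      rw [← Finset.smul_sum, h2, smul_inv_smul₀ hpos.ne']
    have hss : ∑ i ∈ B \ T, s * γ i = s := by rw [← Finset.mul_sum, h1, mul_one]
    refine ⟨fun i => (if i ∈ S then 1 else 0) + if i ∈ T then 0 else s * γ i, fun i hi => ?_,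
      fun i hi => ?_, fun i hi => ?_, ?_, ?_⟩
    · have : 0 ≤ if i ∈ T then 0 else s * γ i := by
        split_ifs with h
        · exact le_rfl
        · exact mul_nonneg hpos.le (h0 i (Finset.mem_sdiff.2 ⟨hi, h⟩))
      have : (0 : ℝ) ≤ if i ∈ S then 1 else 0 := by split_ifs <;> norm_num
      positivity
    · have : 0 ≤ if i ∈ T then 0 else s * γ i := by
        split_ifs with h
        · exact le_rfl
        · exact mul_nonneg hpos.le (h0 i (Finset.mem_sdiff.2 ⟨hSB hi, h⟩))
      simpa [hi] using this
    · simp [hi, hTS hi]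
    · simp only [add_smul, Finset.sum_add_distrib, ite_smul, one_smul, zero_smul, hSsum']
      rw [← Finset.sum_sdiff hTB (f := fun i => if i ∈ T then (0 : Fin d → ℝ) else (s * γ i) • a i),
        Finset.sum_eq_zero (s := T) fun i hi => by simp [hi],
        Finset.sum_congr (s₁ := B \ T) rfl fun i hi => by rw [if_neg (Finset.mem_sdiff.1 hi).2], hyy]
      abel
    · rw [Finset.sum_add_distrib, hSsum]
      rw [← Finset.sum_sdiff hTB (f := fun i => if i ∈ T then 0 else s * γ i),
        Finset.sum_eq_zero (s := T) fun i hi => by simp [hi],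
        Finset.sum_congr (s₁ := B \ T) rfl fun i hi => by rw [if_neg (Finset.mem_sdiff.1 hi).2], hss]
      simp only [hs, Finset.sum_const, nsmul_eq_mul, mul_one, Nat.cast_add]
      ring

open Classical in
/-- Signed decomposition of a slice of a parallelotope into slices of translated cones. -/
lemma indicator_tileSet {n d : ℕ} (a : Fin n → Fin d → ℝ) (I B : Finset (Fin n))
    (y : Fin d → ℝ) (t : ℝ) (ht : ∀ m : ℕ, t ≠ m) :
    (if (Fin.snoc y t : Fin (d + 1) → ℝ) ∈
        tileSet (fun i => (Fin.snoc (a i) 1 : Fin (d + 1) → ℝ)) I B then (1 : ℤ) else 0) =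
      ∑ S ∈ B.powerset, ∑ T ∈ S.powerset, (-1) ^ (#S + #T) *
        (if ((#I + #S : ℕ) : ℝ) < t ∧ (t - (#I + #S : ℕ))⁻¹ •
          (y - (∑ i ∈ I, a i + ∑ i ∈ S, a i)) ∈ convexHull ℝ (a '' ↑(B \ T))
          then (1 : ℤ) else 0) := by
  set K : Set (Fin n → ℝ) := {α | (∀ i ∈ B, 0 ≤ α i) ∧
    (Fin.snoc y t : Fin (d + 1) → ℝ) = ∑ i ∈ I, (Fin.snoc (a i) 1 : Fin (d + 1) → ℝ) +
        ∑ b ∈ B, α b • (Fin.snoc (a b) 1 : Fin (d + 1) → ℝ)} with hKdef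
  have hK : Convex ℝ K := by
    rintro α ⟨h1, h2⟩ β ⟨g1, g2⟩ r s hr hs hrs
    refine ⟨fun i hi => ?_, ?_⟩
    · have := h1 i hi
      have := g1 i hi
      simp only [Pi.add_apply, Pi.smul_apply, smul_eq_mul]
      positivity
    · generalize ∑ i ∈ I, (Fin.snoc (a i) 1 : Fin (d + 1) → ℝ) = p at *
      generalize (Fin.snoc y t : Fin (d + 1) → ℝ) = z at *
      simp only [Pi.add_apply, Pi.smul_apply, smul_eq_mul, add_smul, mul_smul,
        Finset.sum_add_distrib, ← Finset.smul_sum]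
      have e1 : ∑ b ∈ B, α b • (Fin.snoc (a b) 1 : Fin (d + 1) → ℝ) = z - p := by
        rw [h2]; abel
      have e2 : ∑ b ∈ B, β b • (Fin.snoc (a b) 1 : Fin (d + 1) → ℝ) = z - p := by
        rw [g2]; abel
      rw [e1, e2, ← add_smul, hrs, one_smul]
      abel
  have key := indicator_nonempty_expansion B hK
  have e0 : (Fin.snoc y t : Fin (d + 1) → ℝ) ∈
        tileSet (fun i => (Fin.snoc (a i) 1 : Fin (d + 1) → ℝ)) I B ↔
      (K ∩ {α | ∀ i ∈ B, α i ≤ 1}).Nonempty := by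
    constructor
    · rintro ⟨α, h, hz⟩
      exact ⟨α, ⟨fun i hi => (h i hi).1, hz⟩, fun i hi => (h i hi).2⟩
    · rintro ⟨α, ⟨h, hz⟩, h'⟩
      exact ⟨α, fun i hi => ⟨h i hi, h' i hi⟩, hz⟩
  simp only [e0]
  rw [key]
  refine Finset.sum_congr rfl fun S hS => Finset.sum_congr rfl fun T hT => ?_
  congr 1
  refine if_congr ?_ rfl rfl
  rw [← slice_cone a I B S T (Finset.mem_powerset.1 hS) (Finset.mem_powerset.1 hT) y t (ht _)]
  constructor
  · rintro ⟨α, ⟨⟨h, hz⟩, h'⟩, h''⟩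
    exact ⟨α, h, h', h'', hz⟩
  · rintro ⟨α, h, h', h'', hz⟩
    exact ⟨α, ⟨⟨h, hz⟩, h'⟩, h''⟩

/-- An integrable function whose Fourier integrals all vanish is zero almost everywhere. -/
lemma ae_eq_zero_of_forall_integral_mul_cexp_eq_zero {E : Type*} [NormedAddCommGroup E]
    [NormedSpace ℝ E] [MeasurableSpace E] [BorelSpace E] [SecondCountableTopology E]
    [CompleteSpace E] {μ : Measure E} {f : E → ℝ} (hm : Measurable f) (hf : Integrable f μ)
    (h : ∀ L : StrongDual ℝ E, ∫ x, (f x : ℂ) * Complex.exp (L x * Complex.I) ∂μ = 0) :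
    f =ᵐ[μ] 0 := by
  have hf' : Integrable (fun x => -f x) μ := hf.neg
  have := isFiniteMeasure_withDensity_ofReal hf.2
  have := isFiniteMeasure_withDensity_ofReal hf'.2
  have key : μ.withDensity (fun x => ENNReal.ofReal (f x)) =
      μ.withDensity (fun x => ENNReal.ofReal (-f x)) := by
    refine Measure.ext_of_charFunDual (funext fun L => ?_)
    have hbd : ∀ g : E → ℝ, Integrable g μ → Integrable
        (fun x => ((max (g x) 0 : ℝ) : ℂ) * Complex.exp (L x * Complex.I)) μ := fun g hg => by
      refine Integrable.mul_bdd (c := 1) (hg.sup (integrable_zero _ _ _)).ofReal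
        (by fun_prop) (Filter.Eventually.of_forall fun x => ?_)
      rw [Complex.norm_exp_ofReal_mul_I]
    rw [charFunDual_apply, charFunDual_apply,
      integral_withDensity_eq_integral_toReal_smul (by fun_prop) (by simp),
      integral_withDensity_eq_integral_toReal_smul (by fun_prop) (by simp), ← sub_eq_zero]
    simp only [ENNReal.toReal_ofReal', Complex.real_smul]
    rw [← integral_sub (hbd f hf) (hbd _ hf'), ← h L]
    refine integral_congr_ae (Filter.Eventually.of_forall fun x => ?_)
    simp only
    rw [← sub_mul, ← Complex.ofReal_sub]
    congr 2
    rcases le_total 0 (f x) with h0 | h0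
    · rw [max_eq_left h0, max_eq_right (by linarith)]; ring
    · rw [max_eq_right h0, max_eq_left (by linarith)]; ring
  rw [withDensity_eq_iff (by fun_prop) (by fun_prop)] at key
  · filter_upwards [key] with x hx
    have := congrArg ENNReal.toReal hx
    simp only [ENNReal.toReal_ofReal'] at this
    rcases le_total 0 (f x) with h0 | h0
    · rw [max_eq_left h0, max_eq_right (by linarith)] at this; simpa using this
    · rw [max_eq_right h0, max_eq_left (by linarith)] at this
      simp only [Pi.zero_apply]; linarith
  · exact (lt_of_le_of_lt (lintegral_ofReal_le_lintegral_enorm f) hf.2).ne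

/-- The Fourier integral of a translated dilate of a set, through the complex moment generating
function of a linear functional on that set. -/
lemma integral_indicator_dilate_mul_cexp {E : Type*} [NormedAddCommGroup E]
    [NormedSpace ℝ E] [MeasurableSpace E] [BorelSpace E] [FiniteDimensional ℝ E] (μ : Measure E)
    [μ.IsAddHaarMeasure] {K : Set E} (hK : MeasurableSet K) (L : StrongDual ℝ E) (p : E) (r s : ℝ)
    (hs : 0 < s) :
    ∫ y, K.indicator (fun _ => (1 : ℂ)) (s⁻¹ • (y - p)) * Complex.exp ((r • L) y * Complex.I) ∂μ =
      (s : ℂ) ^ Module.finrank ℝ E * Complex.exp (r * L p * Complex.I) *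
        complexMGF L (μ.restrict K) (r * s * Complex.I) := by
  have e1 := integral_sub_right_eq_self (μ := μ) (fun y => K.indicator (fun _ => (1 : ℂ)) (s⁻¹ • y) *
    Complex.exp ((r • L) (y + p) * Complex.I)) p
  simp only [sub_add_cancel] at e1
  have e2 := Measure.integral_comp_inv_smul μ (fun w => K.indicator (fun _ => (1 : ℂ)) w *
    Complex.exp ((r • L) (s • w + p) * Complex.I)) s
  simp only [smul_inv_smul₀ hs.ne'] at e2
  rw [e1, e2, abs_of_pos (pow_pos hs _), complexMGF, ← integral_indicator hK, mul_assoc,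
    ← integral_const_mul, Complex.real_smul, Complex.ofReal_pow]
  congr 1
  refine integral_congr_ae (Filter.Eventually.of_forall fun w => ?_)
  by_cases hw : w ∈ K
  · simp only [Set.indicator_of_mem hw, one_mul, ← Complex.exp_add, map_add, map_smul,
      smul_apply, smul_eq_mul]
    push_cast
    congr 1
    ring
  · simp [Set.indicator_of_notMem hw]

/-- The complex moment generating function of a linear functional on a compact set is entire. -/
lemma analyticOnNhd_complexMGF_restrict_isCompact {E : Type*} [NormedAddCommGroup E]
    [NormedSpace ℝ E] [MeasurableSpace E] [BorelSpace E] [FiniteDimensional ℝ E] (μ : Measure E)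
    [μ.IsAddHaarMeasure] {K : Set E} (hK : IsCompact K) (L : StrongDual ℝ E) :
    AnalyticOnNhd ℂ (complexMGF L (μ.restrict K)) Set.univ := by
  have h : integrableExpSet L (μ.restrict K) = Set.univ := by
    refine Set.eq_univ_of_forall fun t => ?_
    exact ContinuousOn.integrableOn_compact hK (by fun_prop)
  have := analyticOnNhd_complexMGF (X := L) (μ := μ.restrict K)
  simpa [h] using this

/-- A signed sum of dilating simplices `p + (t - m) K` that vanishes between two consecutive
integral times `j` and `j + 1` vanishes asymptotically. -/
lemma ae_sum_indicator_eq_zero_of_dilates {E ι : Type*} [NormedAddCommGroup E]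
    [NormedSpace ℝ E] [MeasurableSpace E] [BorelSpace E] [FiniteDimensional ℝ E] (μ : Measure E)
    [μ.IsAddHaarMeasure] (s : Finset ι) (ε : ι → ℝ) (m : ι → ℕ) (p : ι → E) (K : ι → Set E)
    (hK : ∀ c, IsCompact (K c)) (j : ℕ)
    (h : ∀ᵐ t : ℝ, t ∈ Set.Ioo (j : ℝ) (j + 1) → ∀ᵐ y ∂μ,
      ∑ c ∈ s, ε c * (K c).indicator (fun _ => 1) ((t - m c)⁻¹ • (y - p c)) = 0)
    (hm : ∀ c ∈ s, m c ≤ j) :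
    ∀ᵐ x ∂μ, ∑ c ∈ s, ε c * (K c).indicator (fun _ => 1) x = 0 := by
  have hint : ∀ (c : ι) (a : ℝ) (L : StrongDual ℝ E), 0 < a → ∀ q : E, Integrable (fun y =>
      (K c).indicator (fun _ => (1 : ℂ)) (a⁻¹ • (y - q)) * Complex.exp (L y * Complex.I)) μ := by
    intro c a L ha q
    refine Integrable.mul_bdd (c := 1) ?_ (by fun_prop)
      (Filter.Eventually.of_forall fun x => by rw [Complex.norm_exp_ofReal_mul_I])
    have h1 : Integrable ((K c).indicator (fun _ => (1 : ℂ))) μ :=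
      (integrable_indicator_iff (hK c).measurableSet).2
        (integrableOn_const (hK c).measure_lt_top.ne)
    exact (h1.comp_smul (inv_ne_zero ha.ne')).comp_sub_right q
  set F : StrongDual ℝ E → ℝ → ℝ → ℂ := fun L r t => ∑ c ∈ s, (ε c : ℂ) *
    (((t : ℂ) - m c) ^ Module.finrank ℝ E * Complex.exp (r * L (p c) * Complex.I) *
        complexMGF L (μ.restrict (K c)) (r * (t - m c) * Complex.I)) with hF
  have hFint : ∀ L r t, (∀ c ∈ s, (m c : ℝ) < t) → F L r t = ∫ y, ((∑ c ∈ s, ε c *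
      (K c).indicator (fun _ => 1) ((t - m c)⁻¹ • (y - p c)) : ℝ) : ℂ) *
        Complex.exp ((r • L) y * Complex.I) ∂μ := by
    intro L r t ht
    have e : ∀ y, ((∑ c ∈ s, ε c *
      (K c).indicator (fun _ => 1) ((t - m c)⁻¹ • (y - p c)) : ℝ) : ℂ) *
        Complex.exp ((r • L) y * Complex.I) = ∑ c ∈ s, (ε c : ℂ) *
      ((K c).indicator (fun _ => (1 : ℂ)) ((t - m c)⁻¹ • (y - p c)) *
        Complex.exp ((r • L) y * Complex.I)) := by
      intro y
      rw [Complex.ofReal_sum, Finset.sum_mul]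
      refine Finset.sum_congr rfl fun c _ => ?_
      rw [Complex.ofReal_mul, mul_assoc]
      congr 2
      by_cases hc : (t - m c)⁻¹ • (y - p c) ∈ K c <;> simp [hc]
    simp only [e]
    rw [integral_finsetSum _ fun c hc => (hint c _ _ (sub_pos.2 (ht c hc)) _).const_mul _]
    refine Finset.sum_congr rfl fun c hc => ?_
    rw [integral_const_mul, integral_indicator_dilate_mul_cexp μ (hK c).measurableSet L (p c) r _
      (sub_pos.2 (ht c hc))]
    push_cast
    rfl
  have hMa := fun c L => analyticOnNhd_complexMGF_restrict_isCompact μ (hK c) L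
  have hF0 : ∀ L r t, F L r t = 0 := by
    intro L r
    have hana : AnalyticOnNhd ℝ (F L r) Set.univ := by
      intro t _
      have hofReal : AnalyticAt ℝ (fun t : ℝ => (t : ℂ)) t := Complex.ofRealCLM.analyticAt t
      refine Finset.analyticAt_fun_sum _ fun c _ => ?_
      refine analyticAt_const.mul (((hofReal.sub analyticAt_const).pow _).mul analyticAt_const |>.mul ?_)
      have := ((hMa c L) (r * (t - m c) * Complex.I) trivial).restrictScalars (𝕜 := ℝ)
      exact this.comp_of_eq ((analyticAt_const.mul (hofReal.sub analyticAt_const)).mul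
        analyticAt_const) rfl
    have hzero : Set.EqOn (F L r) 0 (Set.Ioo (j : ℝ) (j + 1)) := by
      refine Measure.eqOn_open_of_ae_eq (μ := volume) ?_ isOpen_Ioo
        (hana.continuousOn.mono (Set.subset_univ _)) continuousOn_const
      refine (ae_restrict_iff' measurableSet_Ioo).2 ?_
      filter_upwards [h] with t ht htj
      rw [hFint L r t fun c hc => lt_of_le_of_lt (by exact_mod_cast hm c hc) htj.1]
      refine integral_eq_zero_of_ae ?_
      filter_upwards [ht htj] with y hy
      rw [hy]
      simp
    have hmem : Set.Ioo (j : ℝ) (j + 1) ∈ nhds ((j : ℝ) + 1 / 2) :=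
      Ioo_mem_nhds (by linarith) (by linarith)
    have := AnalyticOnNhd.eq_of_eventuallyEq hana (analyticOnNhd_const (v := (0 : ℂ)))
      (Filter.eventuallyEq_of_mem hmem hzero)
    intro t
    rw [this]
  refine ae_eq_zero_of_forall_integral_mul_cexp_eq_zero (f := fun x => ∑ c ∈ s, ε c *
    (K c).indicator (fun _ => 1) x) ?_ ?_ fun L => ?_
  · exact Finset.measurable_sum _ fun c _ =>
      (measurable_const.indicator (hK c).measurableSet).const_mul _
  · exact integrable_finsetSum _ fun c _ => ((integrable_indicator_iff (hK c).measurableSet).2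
        (integrableOn_const (hK c).measure_lt_top.ne)).const_mul _
  · set G : ℂ → ℂ := fun u => ∑ c ∈ s, (ε c : ℂ) *
      ((1 - m c * u) ^ Module.finrank ℝ E * Complex.exp (u * L (p c) * Complex.I) *
        complexMGF L (μ.restrict (K c)) ((1 - m c * u) * Complex.I)) with hG
    have hGc : Continuous G := by
      refine continuous_finsetSum _ fun c _ => ?_
      have hc : Continuous (complexMGF L (μ.restrict (K c))) :=
        continuousOn_univ.1 (hMa c L).continuousOn
      have := hc.comp (show Continuous fun u : ℂ => (1 - m c * u) * Complex.I by fun_prop)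
      fun_prop
    have hG0 : ∀ t : ℝ, 0 < t → G ((t⁻¹ : ℝ) : ℂ) = 0 := by
      intro t ht
      have h0 := hF0 L t⁻¹ t
      have htc : (t : ℂ) ≠ 0 := Complex.ofReal_ne_zero.2 ht.ne'
      have : F L t⁻¹ t = (t : ℂ) ^ Module.finrank ℝ E * G ((t⁻¹ : ℝ) : ℂ) := by
        rw [hF, hG, Finset.mul_sum]
        refine Finset.sum_congr rfl fun c _ => ?_
        have e1 : (t : ℂ) - m c = t * (1 - m c * ((t⁻¹ : ℝ) : ℂ)) := by
          push_cast; field_simp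
        have e2 : ((t⁻¹ : ℝ) : ℂ) * (t - m c) = 1 - m c * ((t⁻¹ : ℝ) : ℂ) := by
          push_cast; field_simp
        rw [e2, e1, mul_pow]
        ring
      rw [this] at h0
      exact (mul_eq_zero.1 h0).resolve_left (pow_ne_zero _ htc)
    have hlim : Filter.Tendsto (fun t : ℝ => G ((t⁻¹ : ℝ) : ℂ)) Filter.atTop (nhds (G 0)) := by
      refine (hGc.tendsto 0).comp ?_
      have := (Complex.continuous_ofReal.tendsto 0).comp tendsto_inv_atTop_zero
      rwa [Complex.ofReal_zero] at this
    have hG00 : G 0 = 0 := by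
      refine tendsto_nhds_unique hlim (tendsto_const_nhds.congr' ?_)
      filter_upwards [Filter.eventually_gt_atTop (0 : ℝ)] with t ht using (hG0 t ht).symm
    have e : ∀ x, ((∑ c ∈ s, ε c * (K c).indicator (fun _ => 1) x : ℝ) : ℂ) *
        Complex.exp (L x * Complex.I) = ∑ c ∈ s, (ε c : ℂ) *
      ((K c).indicator (fun x => Complex.exp (Complex.I * L x)) x) := by
      intro x
      rw [Complex.ofReal_sum, Finset.sum_mul]
      refine Finset.sum_congr rfl fun c _ => ?_
      by_cases hc : x ∈ K c <;> simp [hc, mul_comm]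
    simp only [e]
    rw [integral_finsetSum, ← hG00, hG]
    · refine Finset.sum_congr rfl fun c hc => ?_
      rw [integral_const_mul, integral_indicator (hK c).measurableSet]
      simp [complexMGF]
    · refine fun c _ => Integrable.const_mul ?_ _
      refine (integrable_indicator_iff (hK c).measurableSet).2 ?_
      exact ContinuousOn.integrableOn_compact (hK c) (by fun_prop)

lemma convex_tileSet {n : ℕ} {E : Type*} [AddCommGroup E] [Module ℝ E] (v : Fin n → E)
    (I B : Finset (Fin n)) : Convex ℝ (tileSet v I B) := by
  rintro _ ⟨α, h1, rfl⟩ _ ⟨β, g1, rfl⟩ r s hr hs hrs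
  refine ⟨fun i => r * α i + s * β i,
    fun i hi => convex_Icc (0 : ℝ) 1 (h1 i hi) (g1 i hi) hr hs hrs, ?_⟩
  simp only [add_smul, mul_smul, Finset.sum_add_distrib, ← Finset.smul_sum, smul_add]
  rw [add_add_add_comm, ← add_smul, hrs, one_smul]

open Classical in
/-- Almost every point of the zonotope lies in exactly one tile. -/
lemma IsFineZonotopalTiling.ae_sum_indicator {n d : ℕ} {v : Fin n → Fin (d + 1) → ℝ}
    {P : Finset (Finset (Fin n) × Finset (Fin n))} (hP : IsFineZonotopalTiling d v P) :
    ∀ᵐ z : Fin (d + 1) → ℝ, ∑ p ∈ P, (if z ∈ tileSet v p.1 p.2 then (1 : ℤ) else 0) =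
      if z ∈ tileSet v ∅ Finset.univ then 1 else 0 := by
  have h : ∀ᵐ z : Fin (d + 1) → ℝ, ∀ p ∈ P, z ∉ frontier (tileSet v p.1 p.2) :=
    (ae_ball_iff P.countable_toSet).2 fun p _ =>
      measure_eq_zero_iff_ae_notMem.1 ((convex_tileSet v p.1 p.2).addHaar_frontier volume)
  filter_upwards [h] with z hz
  have hint : ∀ p ∈ P, z ∈ tileSet v p.1 p.2 → z ∈ interior (tileSet v p.1 p.2) :=
    fun p hp hzp => by
      by_contra hn
      exact hz p hp ⟨subset_closure hzp, hn⟩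
  rw [← hP.cover]
  split_ifs with hmem
  · obtain ⟨p, hp, hzp⟩ := Set.mem_iUnion₂.1 hmem
    rw [Finset.sum_eq_single_of_mem p hp, if_pos hzp]
    intro q hq hqp
    refine if_neg fun hzq => ?_
    have : z ∈ interior (tileSet v q.1 q.2) ∩ interior (tileSet v p.1 p.2) :=
      ⟨hint q hq hzq, hint p hp hzp⟩
    rw [hP.intdisj q hq p hp hqp] at this
    exact this
  · refine Finset.sum_eq_zero fun p hp => if_neg fun hzp => hmem ?_
    exact Set.mem_iUnion₂.2 ⟨p, hp, hzp⟩

/-- Almost every point of almost every horizontal slice has a property that holds almost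
everywhere. -/
lemma ae_ae_snoc {d : ℕ} {Q : (Fin (d + 1) → ℝ) → Prop} (h : ∀ᵐ z, Q z) :
    ∀ᵐ t : ℝ, ∀ᵐ y : Fin d → ℝ, Q (Fin.snoc y t) := by
  have hmp := (volume_preserving_piFinSuccAbove (fun _ : Fin (d + 1) => ℝ) (Fin.last d)).symm
  have := Measure.ae_ae_of_ae_prod (hmp.quasiMeasurePreserving.ae h)
  filter_upwards [this] with t ht
  filter_upwards [ht] with y hy
  convert hy using 1
  simp [MeasurableEquiv.piFinSuccAbove, Fin.insertNthEquiv]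

open Classical in
/-- The signed number of simplices containing `x` among those spanned by the translated cones in
the decomposition of the tile `Π_{I,B}` whose apex has a height satisfying `φ`. -/
noncomputable def coneSum {n d : ℕ} (a : Fin n → Fin d → ℝ)
    (p : Finset (Fin n) × Finset (Fin n)) (φ : ℕ → Prop) [DecidablePred φ]
    (x : Fin d → ℝ) : ℤ :=
  ∑ S ∈ p.2.powerset, ∑ T ∈ S.powerset, (-1) ^ (#S + #T) *
    (if φ (#p.1 + #S) ∧ x ∈ convexHull ℝ (a '' ↑(p.2 \ T)) then 1 else 0)

lemma coneSum_le_succ {n d : ℕ} (a : Fin n → Fin d → ℝ) (p : Finset (Fin n) × Finset (Fin n))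
    (j : ℕ) (x : Fin d → ℝ) :
    coneSum a p (· ≤ j + 1) x = coneSum a p (· ≤ j) x + coneSum a p (· = j + 1) x := by
  simp only [coneSum, ← Finset.sum_add_distrib, ← mul_add]
  refine Finset.sum_congr rfl fun S _ => Finset.sum_congr rfl fun T _ => ?_
  by_cases hx : x ∈ convexHull ℝ (a '' ↑(p.2 \ T))
  · rcases lt_trichotomy (#p.1 + #S) (j + 1) with h | h | h
    · rw [if_pos ⟨h.le, hx⟩, if_pos ⟨Nat.lt_succ_iff.1 h, hx⟩, if_neg fun g => h.ne g.1, add_zero]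
    · rw [if_pos ⟨h.le, hx⟩, if_neg fun g => absurd g.1 (by omega), if_pos ⟨h, hx⟩, zero_add]
    · rw [if_neg fun g => absurd g.1 (by omega), if_neg fun g => absurd g.1 (by omega),
        if_neg fun g => h.ne' g.1, add_zero]
  · rw [if_neg fun g => hx g.2, if_neg fun g => hx g.2, if_neg fun g => hx g.2, add_zero]

lemma cast_mul_ite_and {X : Type*} (φ : Prop) [Decidable φ] (K : Set X) (x : X)
    [Decidable (φ ∧ x ∈ K)] (c e : ℤ) :
    ((c * (e * if φ ∧ x ∈ K then 1 else 0) : ℤ) : ℝ) =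
      if φ then ((c * e : ℤ) : ℝ) * K.indicator (fun _ => 1) x else 0 := by
  by_cases h1 : φ <;> by_cases h2 : x ∈ K <;> simp [h1, h2]

lemma IsFineZonotopalTiling.ae_sum_coneSum_le {n d : ℕ} {a : Fin n → Fin d → ℝ}
    {P : Finset (Finset (Fin n) × Finset (Fin n))}
    (hP : IsFineZonotopalTiling d (fun i => (Fin.snoc (a i) 1 : Fin (d + 1) → ℝ)) P) (j : ℕ) :
    ∀ᵐ x : Fin d → ℝ, ∑ p ∈ P, coneSum a p (· ≤ j) x =
      coneSum a (∅, Finset.univ) (· ≤ j) x := by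
  classical
  set w : Finset (Fin n) × Finset (Fin n) → ℤ := fun p =>
    (if p ∈ P then 1 else 0) - if p = (∅, Finset.univ) then 1 else 0 with hw
  have hwsum : ∀ f : Finset (Fin n) × Finset (Fin n) → ℤ,
      ∑ p, w p * f p = ∑ p ∈ P, f p - f (∅, Finset.univ) := by
    intro f
    simp [hw, sub_mul, Finset.sum_sub_distrib, ite_mul]
  set s : Finset (Σ _ : Finset (Fin n) × Finset (Fin n), Σ _ : Finset (Fin n), Finset (Fin n)) :=
    Finset.univ.sigma fun p => p.2.powerset.sigma fun S => S.powerset with hs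
  have key := ae_sum_indicator_eq_zero_of_dilates (volume : Measure (Fin d → ℝ))
    (s.filter fun c => #c.1.1 + #c.2.1 ≤ j)
    (fun c => (w c.1 * (-1) ^ (#c.2.1 + #c.2.2) : ℤ)) (fun c => #c.1.1 + #c.2.1)
    (fun c => ∑ i ∈ c.1.1, a i + ∑ i ∈ c.2.1, a i)
    (fun c => convexHull ℝ (a '' ↑(c.1.2 \ c.2.2)))
    (fun c => ((c.1.2 \ c.2.2).finite_toSet.image a).isCompact_convexHull ℝ) j ?_
    (fun c hc => (Finset.mem_filter.1 hc).2)
  · filter_upwards [key] with x hx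
    rw [← sub_eq_zero, ← hwsum]
    rw [Finset.sum_filter, hs, Finset.sum_sigma] at hx
    simp only [Finset.sum_sigma] at hx
    rw [← Int.cast_inj (α := ℝ), Int.cast_zero]
    refine Eq.trans ?_ hx
    simp only [coneSum, Finset.mul_sum, Int.cast_sum]
    exact Finset.sum_congr rfl fun p _ => Finset.sum_congr rfl fun S _ =>
      Finset.sum_congr rfl fun T _ => cast_mul_ite_and _ _ _ _ _
  · filter_upwards [ae_ae_snoc hP.ae_sum_indicator] with t ht htj
    have hne : ∀ m : ℕ, t ≠ m := by
      rintro m rfl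
      have h1 : j < m := by exact_mod_cast htj.1
      have h2 : m < j + 1 := by exact_mod_cast htj.2
      omega
    have hlt : ∀ m : ℕ, (m : ℝ) < t ↔ m ≤ j := by
      intro m
      constructor
      · intro h
        have : (m : ℝ) < j + 1 := h.trans htj.2
        have : m < j + 1 := by exact_mod_cast this
        omega
      · intro h
        exact lt_of_le_of_lt (by exact_mod_cast h) htj.1
    filter_upwards [ht] with y hy
    rw [← sub_eq_zero, ← hwsum fun p => if (Fin.snoc y t : Fin (d + 1) → ℝ) ∈
      tileSet (fun i => (Fin.snoc (a i) 1 : Fin (d + 1) → ℝ)) p.1 p.2 then 1 else 0] at hy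
    rw [Finset.sum_filter, hs, Finset.sum_sigma]
    simp only [Finset.sum_sigma]
    rw [← Int.cast_inj (α := ℝ), Int.cast_zero] at hy
    refine Eq.trans ?_ hy
    simp only [indicator_tileSet a _ _ y t hne, hlt, Finset.mul_sum, Int.cast_sum]
    exact Finset.sum_congr rfl fun p _ => Finset.sum_congr rfl fun S _ =>
      Finset.sum_congr rfl fun T _ => (cast_mul_ite_and _ _ _ _ _).symm

lemma IsFineZonotopalTiling.ae_sum_coneSum_eq {n d : ℕ} {a : Fin n → Fin d → ℝ}
    {P : Finset (Finset (Fin n) × Finset (Fin n))}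
    (hP : IsFineZonotopalTiling d (fun i => (Fin.snoc (a i) 1 : Fin (d + 1) → ℝ)) P) :
    ∀ᵐ x : Fin d → ℝ, ∀ j, ∑ p ∈ P, coneSum a p (· = j) x =
      coneSum a (∅, Finset.univ) (· = j) x := by
  filter_upwards [ae_all_iff.2 hP.ae_sum_coneSum_le] with x hx j
  cases j with
  | zero => simpa using hx 0
  | succ j =>
    have h1 := hx (j + 1)
    simp only [coneSum_le_succ, Finset.sum_add_distrib, hx j] at h1
    linarith

/-- Almost every point avoids all simplices spanned by at most `d` points. -/
lemma ae_forall_notMem_convexHull {n d : ℕ} (a : Fin n → Fin d → ℝ) :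
    ∀ᵐ x : Fin d → ℝ, ∀ W : Finset (Fin n), #W ≤ d → x ∉ convexHull ℝ (a '' ↑W) := by
  classical
  refine ae_all_iff.2 fun W => ?_
  by_cases hW : #W ≤ d
  · refine Filter.Eventually.mono ?_ fun x hx _ => hx
    rcases W.eq_empty_or_nonempty with rfl | hne
    · simp
    have hspan : affineSpan ℝ (a '' ↑W) ≠ ⊤ := by
      intro htop
      have h1 : vectorSpan ℝ (a '' ↑W) = ⊤ := by
        rw [← direction_affineSpan, htop, AffineSubspace.direction_top]
      have h2 := finrank_vectorSpan_image_finset_le ℝ a W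
        (Nat.succ_pred_eq_of_pos (Finset.card_pos.2 hne)).symm
      rw [Finset.coe_image, h1, finrank_top, Module.finrank_fin_fun] at h2
      have := Finset.card_pos.2 hne
      have h3 : (#W).pred < #W := Nat.pred_lt this.ne'
      omega
    have := measure_eq_zero_iff_ae_notMem.1 (Measure.addHaar_affineSubspace volume _ hspan)
    filter_upwards [this] with x hx hxc
    exact hx (convexHull_subset_affineSpan _ hxc)
  · exact Filter.Eventually.of_forall fun x h => absurd h hW

open Classical in
lemma coneSum_eq_of_generic {n d : ℕ} {a : Fin n → Fin d → ℝ} {x : Fin d → ℝ}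
    (hx : ∀ W : Finset (Fin n), #W ≤ d → x ∉ convexHull ℝ (a '' ↑W))
    (p : Finset (Fin n) × Finset (Fin n)) (hp : #p.2 = d + 1) (j : ℕ) :
    coneSum a p (· = j) x = if x ∈ convexHull ℝ (a '' ↑p.2) then
      ∑ S ∈ p.2.powerset, (-1) ^ #S * (if #p.1 + #S = j then 1 else 0) else 0 := by
  have h : ∀ S ∈ p.2.powerset, ∑ T ∈ S.powerset, (-1 : ℤ) ^ (#S + #T) *
      (if #p.1 + #S = j ∧ x ∈ convexHull ℝ (a '' ↑(p.2 \ T)) then 1 else 0) =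
      if x ∈ convexHull ℝ (a '' ↑p.2) then (-1) ^ #S * (if #p.1 + #S = j then 1 else 0) else 0 := by
    intro S hS
    rw [Finset.sum_eq_single_of_mem ∅ (Finset.empty_mem_powerset S)]
    · by_cases h : x ∈ convexHull ℝ (a '' ↑p.2) <;> simp [h]
    · intro T hT hT0
      have hTp := (Finset.mem_powerset.1 hT).trans (Finset.mem_powerset.1 hS)
      have hc := Finset.card_sdiff_of_subset hTp
      have := Finset.card_pos.2 (Finset.nonempty_iff_ne_empty.2 hT0)
      rw [if_neg fun h => hx (p.2 \ T) (by omega) h.2, mul_zero]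
  rw [coneSum, Finset.sum_congr rfl h]
  split_ifs <;> simp

lemma coneSum_univ_of_deep {n d k : ℕ} {a : Fin n → Fin d → ℝ} {x : Fin d → ℝ}
    (hx : ∀ S : Finset (Fin n), #S = n - k → x ∈ convexHull ℝ (a '' ↑S)) {j : ℕ} (hj : j ≤ k) :
    coneSum a (∅, Finset.univ) (· = j) x = if j = 0 then 1 else 0 := by
  classical
  have h : ∀ S ∈ (Finset.univ : Finset (Fin n)).powerset, ∑ T ∈ S.powerset, (-1 : ℤ) ^ (#S + #T) *
      (if #(∅ : Finset (Fin n)) + #S = j ∧ x ∈ convexHull ℝ (a '' ↑(Finset.univ \ T))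
        then 1 else 0) = if S = ∅ then if j = 0 then 1 else 0 else 0 := by
    intro S _
    by_cases hSj : #S = j
    · have hmem : ∀ T ∈ S.powerset, x ∈ convexHull ℝ (a '' ↑(Finset.univ \ T)) := by
        intro T hT
        have hTk : #T ≤ k := (Finset.card_le_card (Finset.mem_powerset.1 hT)).trans (hSj ▸ hj)
        have hc : n - k ≤ #(Finset.univ \ T) := by
          rw [Finset.card_univ_sdiff, Fintype.card_fin]; omega
        obtain ⟨U, hU, hUc⟩ := Finset.exists_subset_card_eq hc
        exact convexHull_mono (Set.image_mono (Finset.coe_subset.2 hU)) (hx U hUc)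
      rw [Finset.sum_congr rfl fun T hT => by
        rw [if_pos ⟨by simpa using hSj, hmem T hT⟩, mul_one, pow_add],
        ← Finset.mul_sum, Finset.sum_powerset_neg_one_pow_card]
      rcases eq_or_ne S ∅ with rfl | hS
      · simp at hSj; simp [← hSj]
      · simp [hS]
    · rw [Finset.sum_eq_zero fun T _ => by rw [if_neg fun h => hSj (by simpa using h.1), mul_zero]]
      rcases eq_or_ne S ∅ with rfl | hS
      · rw [Finset.card_empty] at hSj; simp [Ne.symm hSj]
      · simp [hS]
  simp only [coneSum]
  rw [Finset.sum_congr rfl h]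
  simp

/-- A power series whose product with `(1 - X) ^ (d + 1)` is `1` up to order `k` has the binomial
coefficient `C(k + d, d)` as its `k`-th coefficient. -/
lemma coeff_eq_choose_of_mul_one_sub_pow {d k : ℕ} (N : PowerSeries ℤ)
    (h : ∀ j ≤ k, PowerSeries.coeff j (N * (1 - PowerSeries.X) ^ (d + 1)) =
      if j = 0 then 1 else 0) :
    PowerSeries.coeff k N = Nat.choose (k + d) d := by
  set Q : PowerSeries ℤ := PowerSeries.mk fun n => ((d + n).choose d : ℤ) with hQ
  have h1 : N = (N * (1 - PowerSeries.X) ^ (d + 1)) * Q := by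
    rw [mul_assoc, mul_comm _ Q, hQ, PowerSeries.mk_add_choose_mul_one_sub_pow_eq_one, mul_one]
  rw [h1, PowerSeries.coeff_mul, Finset.sum_eq_single_of_mem (0, k) (by simp)]
  · rw [h 0 k.zero_le, hQ, PowerSeries.coeff_mk, add_comm k d]
    simp
  · rintro ⟨i, l⟩ hil hne
    have hil' : i + l = k := by simpa using hil
    rw [h i (by omega), if_neg, zero_mul]
    rintro rfl
    simp at hil'
    exact hne (by rw [hil'])

/-- **Cover multiplicity.** For a fine zonotopal tiling of the lifted configuration and
`0 ≤ k ≤ n-d-1`, almost every point of `ch_k(A)` (the intersection of the convex hulls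
of all subconfigurations of size `n-k`) is covered by exactly `C(k+d, d)` of the
simplices `conv({a_b : b ∈ B})` arising from tiles of order `k`. -/
theorem cover_multiplicity (n d k : ℕ) (a : Fin n → (Fin d → ℝ))
    (hspan : affineSpan ℝ (Set.range a) = ⊤)
    (P : Finset (Finset (Fin n) × Finset (Fin n)))
    (hP : IsFineZonotopalTiling d (fun i => (Fin.snoc (a i) 1 : Fin (d + 1) → ℝ)) P)
    (hk : k ≤ n - d - 1) :
    ∀ᵐ x : Fin d → ℝ ∂MeasureTheory.volume,
      x ∈ (⋂ S : Finset (Fin n), ⋂ (_ : S.card = n - k), convexHull ℝ (a '' ↑S)) →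
      Set.ncard {p : Finset (Fin n) × Finset (Fin n) |
          p ∈ P ∧ p.1.card = k ∧ x ∈ convexHull ℝ (a '' ↑p.2)}
        = Nat.choose (k + d) d := by
  classical
  filter_upwards [hP.ae_sum_coneSum_eq, ae_forall_notMem_convexHull a] with x hsum hgen hx
  have hdeep : ∀ S : Finset (Fin n), #S = n - k → x ∈ convexHull ℝ (a '' ↑S) :=
    fun S hS => Set.mem_iInter₂.1 hx S hS
  set N : PowerSeries ℤ :=
    ∑ p ∈ P with x ∈ convexHull ℝ (a '' ↑p.2), PowerSeries.X ^ #p.1 with hN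
  have hcoeff : ∀ j ≤ k, PowerSeries.coeff j (N * (1 - PowerSeries.X) ^ (d + 1)) =
      if j = 0 then 1 else 0 := by
    intro j hj
    rw [← coneSum_univ_of_deep hdeep hj, ← hsum j, hN, Finset.sum_mul, map_sum, Finset.sum_filter]
    refine Finset.sum_congr rfl fun p hp => ?_
    rw [coneSum_eq_of_generic hgen p (hP.cardB p hp) j]
    refine if_congr Iff.rfl ?_ rfl
    have e := Finset.sum_pow_mul_eq_add_pow (-PowerSeries.X : PowerSeries ℤ) 1 p.2
    rw [hP.cardB p hp, neg_add_eq_sub] at e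
    rw [← e, Finset.mul_sum, map_sum]
    refine Finset.sum_congr rfl fun S _ => ?_
    have e2 : (PowerSeries.X ^ #p.1 * ((-PowerSeries.X) ^ #S * 1 ^ (d + 1 - #S)) : PowerSeries ℤ) =
        PowerSeries.C ((-1) ^ #S) * PowerSeries.X ^ (#p.1 + #S) := by
      rw [neg_pow, one_pow, mul_one, pow_add, map_pow, map_neg, map_one]
      ring
    rw [e2, PowerSeries.coeff_C_mul, PowerSeries.coeff_X_pow]
    simp only [eq_comm]
  have hk' := coeff_eq_choose_of_mul_one_sub_pow N hcoeff
  have hset : {p : Finset (Fin n) × Finset (Fin n) |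
      p ∈ P ∧ p.1.card = k ∧ x ∈ convexHull ℝ (a '' ↑p.2)} =
      ↑((P.filter fun p => x ∈ convexHull ℝ (a '' ↑p.2)).filter fun p => k = #p.1) := by
    ext p
    simp only [Set.mem_ofPred_eq, Finset.coe_filter, Finset.mem_filter]
    tauto
  rw [hset, Set.ncard_coe_finset]
  rw [hN, map_sum] at hk'
  simp only [PowerSeries.coeff_X_pow] at hk'
  rw [Finset.sum_boole] at hk'
  exact_mod_cast hk'
end

section
/- Let P(h) be a regular fine zonotopal tiling induced by a generic height function h, let x ∈ conv(A) be generic, and let Π_{∅,Z} be the unique order-zero tile with x ∈ conv({a_b}_{b∈Z}). Then for every tile Π_{I',B'} ∈ P(h) with x ∈ conv({a_i}_{i∈I'⊔B'}), there exists a directed path in (G, o_x) from Π_{∅,Z} to Π_{I',B'} such that every tile Π_{I,B} along the path satisfies x ∈ conv({a_i}_{i∈I⊔B}) and |I| ≤ |I'|. -/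
open Finset

/-- The oriented adjacency relation on the tiles of a fine zonotopal tiling of the
lifted configuration: `p → q` iff `p` and `q` are distinct tiles of `P` sharing a facet
(i.e. `B \ {b} = B' \ {b'}` with the corresponding relation between `I` and `I'`), and
the facet normal `N` whose pairing with the lift `(x,1)` is positive points from `p`
to `q`. -/
def stepRel {n d : ℕ} (a : Fin n → (Fin d → ℝ))
    (P : Finset (Finset (Fin n) × Finset (Fin n))) (x : Fin d → ℝ)
    (p q : Finset (Fin n) × Finset (Fin n)) : Prop :=
  p ∈ P ∧ q ∈ P ∧ p ≠ q ∧
  ∃ b ∈ p.2, ∃ b' ∈ q.2, p.2.erase b = q.2.erase b' ∧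
    (p.1 = q.1 ∨ p.1 = insert b' q.1 ∨ q.1 = insert b p.1 ∨
      insert b p.1 = insert b' q.1) ∧
    ∃ N : Fin (d + 1) → ℝ, N ≠ 0 ∧
      (∀ c ∈ p.2.erase b, ∑ j, N j * (Fin.snoc (a c) 1 : Fin (d + 1) → ℝ) j = 0) ∧
      0 < ∑ j, N j * (Fin.snoc x 1 : Fin (d + 1) → ℝ) j ∧
      ∀ z ∈ tileSet (fun i => (Fin.snoc (a i) 1 : Fin (d + 1) → ℝ)) p.1 p.2,
        ∀ z' ∈ tileSet (fun i => (Fin.snoc (a i) 1 : Fin (d + 1) → ℝ)) q.1 q.2,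
          0 ≤ ∑ j, N j * (z' j - z j)

/-- `α` is the vector of zonotope coordinates of a point of the tile `p = (I, B)`: it takes
values in `[0, 1]`, equals `1` on `I` and vanishes outside `I ∪ B`. -/
def IsTileCoords {n : ℕ} (p : Finset (Fin n) × Finset (Fin n)) (α : Fin n → ℝ) : Prop :=
  (∀ i, 0 ≤ α i ∧ α i ≤ 1) ∧ (∀ i ∈ p.1, α i = 1) ∧ ∀ i ∉ p.1 ∪ p.2, α i = 0

/-- The linear functional `L` has its graph below the heights on `I`, through the heights
on `B`, and above the heights elsewhere. -/
def IsTileFunctional {n : ℕ} {E : Type*} [AddCommGroup E] [Module ℝ E] (v : Fin n → E)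
    (h : Fin n → ℝ) (p : Finset (Fin n) × Finset (Fin n)) (L : E →ₗ[ℝ] ℝ) : Prop :=
  (∀ i ∈ p.1, L (v i) < h i) ∧ (∀ i ∈ p.2, L (v i) = h i) ∧
    ∀ i ∉ p.1 ∪ p.2, h i < L (v i)

section Tiles

variable {n : ℕ} {E : Type*} [AddCommGroup E] [Module ℝ E] {v : Fin n → E}

lemma IsTileCoords.sum_eq {p : Finset (Fin n) × Finset (Fin n)} {α : Fin n → ℝ}
    (hα : IsTileCoords p α) (hd : Disjoint p.1 p.2) :
    ∑ i, α i • v i = ∑ i ∈ p.1, v i + ∑ b ∈ p.2, α b • v b := by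
  rw [← Finset.sum_subset (Finset.subset_univ (p.1 ∪ p.2))
    (fun i _ hi => by rw [hα.2.2 i hi, zero_smul]), Finset.sum_union hd]
  congr 1
  exact Finset.sum_congr rfl fun i hi => by rw [hα.2.1 i hi, one_smul]

lemma mem_tileSet_iff {p : Finset (Fin n) × Finset (Fin n)} (hd : Disjoint p.1 p.2) {z : E} :
    z ∈ tileSet v p.1 p.2 ↔ ∃ α, IsTileCoords p α ∧ z = ∑ i, α i • v i := by
  constructor
  · rintro ⟨α, hα, rfl⟩
    have hβ : IsTileCoords p fun i => if i ∈ p.1 then 1 else if i ∈ p.2 then α i else 0 := by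
      refine ⟨fun i => ?_, fun i hi => by simp [hi], fun i hi => ?_⟩
      · dsimp only
        split_ifs with h1 h2
        · norm_num
        · exact hα i h2
        · norm_num
      · rw [Finset.mem_union, not_or] at hi
        simp [hi.1, hi.2]
    refine ⟨_, hβ, ?_⟩
    rw [hβ.sum_eq hd]
    congr 1
    refine Finset.sum_congr rfl fun b hb => ?_
    have : b ∉ p.1 := fun hb' => Finset.disjoint_left.mp hd hb' hb
    simp [this, hb]
  · rintro ⟨α, hα, rfl⟩
    exact ⟨α, fun b _ => hα.1 b, hα.sum_eq hd⟩

lemma isClosed_tileSet [TopologicalSpace E] [IsTopologicalAddGroup E] [ContinuousSMul ℝ E]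
    [T2Space E] (v : Fin n → E) (I B : Finset (Fin n)) : IsClosed (tileSet v I B) := by
  have hc : IsCompact (Set.pi Set.univ fun _ : Fin n => Set.Icc (0 : ℝ) 1) :=
    isCompact_univ_pi fun _ => isCompact_Icc
  have hcont : Continuous fun α : Fin n → ℝ => (∑ i ∈ I, v i) + ∑ b ∈ B, α b • v b := by
    fun_prop
  convert (hc.image hcont).isClosed
  ext z
  constructor
  · rintro ⟨α, hα, rfl⟩
    refine ⟨fun i => if i ∈ B then α i else 0, fun i _ => ?_, ?_⟩
    · dsimp only
      split_ifs with hi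
      · exact hα i hi
      · simp
    · dsimp only
      congr 1
      exact Finset.sum_congr rfl fun b hb => by simp [hb]
  · rintro ⟨α, hα, rfl⟩
    exact ⟨α, fun b _ => hα b trivial, rfl⟩

/-- A tile coordinate vector maximizes the total height over its fibre. -/
lemma IsTileFunctional.mul_nonneg {p : Finset (Fin n) × Finset (Fin n)} {h : Fin n → ℝ}
    {L : E →ₗ[ℝ] ℝ} (hL : IsTileFunctional v h p L) {α β : Fin n → ℝ}
    (hα : IsTileCoords p α) (hβ : ∀ i, 0 ≤ β i ∧ β i ≤ 1) (i : Fin n) :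
    0 ≤ (α i - β i) * (h i - L (v i)) := by
  by_cases h1 : i ∈ p.1
  · have := hL.1 i h1
    rw [hα.2.1 i h1]
    exact _root_.mul_nonneg (by linarith [(hβ i).2]) (by linarith)
  by_cases h2 : i ∈ p.2
  · rw [hL.2.1 i h2]; simp
  · have h3 : i ∉ p.1 ∪ p.2 := by simp [h1, h2]
    have := hL.2.2 i h3
    rw [hα.2.2 i h3]
    exact mul_nonneg_of_nonpos_of_nonpos (by linarith [(hβ i).1]) (by linarith)

/-- In a regular tiling the coordinates of a point do not depend on the tile used to
compute them. -/
lemma IsTileCoords.eq_of_sum_eq {p q : Finset (Fin n) × Finset (Fin n)} {h : Fin n → ℝ}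
    {L M : E →ₗ[ℝ] ℝ} (hL : IsTileFunctional v h p L) (hM : IsTileFunctional v h q M)
    (hp : LinearIndependent ℝ (fun b : p.2 => v ↑b)) {α β : Fin n → ℝ}
    (hα : IsTileCoords p α) (hβ : IsTileCoords q β)
    (hs : ∑ i, α i • v i = ∑ i, β i • v i) : α = β := by
  have key : ∀ K : E →ₗ[ℝ] ℝ,
      ∑ i, (α i - β i) * (h i - K (v i)) = ∑ i, (α i - β i) * h i := by
    intro K
    have := congrArg K hs
    simp only [map_sum, map_smul, smul_eq_mul] at this
    simp only [mul_sub, sub_mul, Finset.sum_sub_distrib]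
    linarith
  have h1 := Finset.sum_nonneg fun i (_ : i ∈ Finset.univ) => hL.mul_nonneg hα hβ.1 i
  have h2 := Finset.sum_nonneg fun i (_ : i ∈ Finset.univ) => hM.mul_nonneg hβ hα.1 i
  have h3 : ∑ i, (β i - α i) * (h i - M (v i)) = - ∑ i, (α i - β i) * (h i - M (v i)) := by
    rw [← Finset.sum_neg_distrib]
    exact Finset.sum_congr rfl fun i _ => by ring
  rw [h3, key] at h2
  have h4 : ∑ i, (α i - β i) * (h i - L (v i)) = 0 := by
    rw [key] at h1 ⊢
    linarith
  have h5 := (Finset.sum_eq_zero_iff_of_nonneg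
    fun i _ => hL.mul_nonneg hα hβ.1 i).mp h4
  have hout : ∀ i ∉ p.2, α i - β i = 0 := by
    intro i hi
    rcases mul_eq_zero.mp (h5 i (Finset.mem_univ i)) with h6 | h6
    · exact h6
    · exfalso
      by_cases hi1 : i ∈ p.1
      · linarith [hL.1 i hi1]
      · linarith [hL.2.2 i (by simp [hi, hi1])]
  have hsum : ∑ b : p.2, (α b - β b) • v b = 0 := by
    rw [Finset.sum_coe_sort p.2 fun b => (α b - β b) • v b,
      Finset.sum_subset (Finset.subset_univ p.2) fun i _ hi => by rw [hout i hi, zero_smul]]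
    simp only [sub_smul, Finset.sum_sub_distrib, hs, sub_self]
  have hin := Fintype.linearIndependent_iff.mp hp (fun b => α b - β b) hsum
  funext i
  by_cases hi : i ∈ p.2
  · exact sub_eq_zero.mp (hin ⟨i, hi⟩)
  · exact sub_eq_zero.mp (hout i hi)

/-- A lower facet of a tile that is not extremal for the zonotope is shared with a tile on the
other side of it. -/
lemma exists_adjacent_tile [TopologicalSpace E] [IsTopologicalAddGroup E] [ContinuousSMul ℝ E]
    [T2Space E] {d : ℕ} {h : Fin n → ℝ} {P : Finset (Finset (Fin n) × Finset (Fin n))}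
    (hP : IsFineZonotopalTiling d v P)
    (hreg : ∀ p ∈ P, ∃ L : E →ₗ[ℝ] ℝ, IsTileFunctional v h p L)
    {p : Finset (Fin n) × Finset (Fin n)} (hp : p ∈ P) {b : Fin n} (hb : b ∈ p.2)
    {N : E →ₗ[ℝ] ℝ} (hN0 : ∀ c ∈ p.2.erase b, N (v c) = 0)
    {i : Fin n} (hi : i ∈ p.1) (hNi : 0 < N (v i)) :
    ∃ q ∈ P, ∃ c ∈ q.2, q.2.erase c = p.2.erase b ∧
      ((q.1 = p.1 ∧ N (v c) < 0) ∨ (p.1 = insert c q.1 ∧ 0 < N (v c))) := by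
  classical
  have hd := hP.disj p hp
  set α : Fin n → ℝ := fun j => if j ∈ p.1 then 1 else if j ∈ p.2.erase b then 1 / 2 else 0
    with hαdef
  have hα : IsTileCoords p α := by
    refine ⟨fun j => ?_, fun j hj => by simp [hαdef, hj], fun j hj => ?_⟩
    · simp only [hαdef]; split_ifs <;> norm_num
    · rw [Finset.mem_union, not_or] at hj
      simp [hαdef, hj.1, hj.2]
  set z := ∑ j, α j • v j with hz
  have hcont : Filter.Tendsto (fun ε : ℝ => z - ε • v i) (nhdsWithin 0 (Set.Ioi 0)) (nhds z) := by
    have : Continuous fun ε : ℝ => z - ε • v i := by fun_prop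
    have h0 := this.tendsto 0
    simp only [zero_smul, sub_zero] at h0
    exact h0.mono_left nhdsWithin_le_nhds
  have hev : ∀ᶠ ε : ℝ in nhdsWithin 0 (Set.Ioi 0),
      ∀ q ∈ P, z - ε • v i ∈ tileSet v q.1 q.2 → z ∈ tileSet v q.1 q.2 := by
    rw [Filter.eventually_all_finset]
    intro q _
    by_cases hzq : z ∈ tileSet v q.1 q.2
    · exact Filter.Eventually.of_forall fun _ _ => hzq
    · filter_upwards [hcont ((isClosed_tileSet v q.1 q.2).isOpen_compl.mem_nhds hzq)]
        with ε hε hε'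
      exact absurd hε' hε
  obtain ⟨ε, hε, hε1⟩ := (hev.and (Ioc_mem_nhdsGT (zero_lt_one' ℝ))).exists
  have hmem : z - ε • v i ∈ tileSet v ∅ Finset.univ := by
    refine (mem_tileSet_iff (p := (∅, Finset.univ)) (by simp)).mpr
      ⟨fun j => α j - if j = i then ε else 0, ⟨fun j => ?_, by simp, by simp⟩, ?_⟩
    · dsimp only
      split_ifs with hj
      · subst hj
        rw [hα.2.1 j hi]
        constructor <;> linarith [hε1.1, hε1.2]
      · simpa using hα.1 j
    · simp [sub_smul, Finset.sum_sub_distrib, hz, ite_smul]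
  rw [← hP.cover] at hmem
  simp only [Set.mem_iUnion] at hmem
  obtain ⟨q, hq, hqε⟩ := hmem
  have hqz := hε q hq hqε
  have hdq := hP.disj q hq
  obtain ⟨β, hβ, hzβ⟩ := (mem_tileSet_iff hdq).mp hqz
  obtain ⟨L, hL⟩ := hreg p hp
  obtain ⟨M, hM⟩ := hreg q hq
  obtain rfl : α = β := hα.eq_of_sum_eq hL hM (hP.indep p hp) hβ (hz.symm.trans hzβ)
  have hCq : p.2.erase b ⊆ q.2 := by
    intro c hc
    have hcp : c ∉ p.1 := fun h' => Finset.disjoint_left.mp hd h' (Finset.mem_of_mem_erase hc)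
    have hαc : α c = 1 / 2 := by simp only [hαdef]; rw [if_neg hcp, if_pos hc]
    by_contra hcq
    by_cases hc1 : c ∈ q.1
    · have := hβ.2.1 c hc1
      norm_num [hαc] at this
    · have := hβ.2.2 c (by simp [hcq, hc1])
      norm_num [hαc] at this
  have hcard : (q.2 \ p.2.erase b).card = 1 := by
    rw [Finset.card_sdiff_of_subset hCq, Finset.card_erase_of_mem hb, hP.cardB p hp,
      hP.cardB q hq]
    omega
  obtain ⟨c, hc⟩ := Finset.card_eq_one.mp hcard
  have hcmem : c ∈ q.2 \ p.2.erase b := by rw [hc]; simp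
  rw [Finset.mem_sdiff] at hcmem
  have hqe : q.2.erase c = p.2.erase b := by
    rw [Finset.erase_eq, ← hc, Finset.sdiff_sdiff_eq_self hCq]
  have hI1 : q.1 ⊆ p.1 := by
    intro j hj
    have h1 := hβ.2.1 j hj
    by_contra hjp
    simp only [hαdef, if_neg hjp] at h1
    split_ifs at h1 <;> norm_num at h1
  have hI2 : p.1 ⊆ insert c q.1 := by
    intro j hj
    by_contra hjq
    rw [Finset.mem_insert, not_or] at hjq
    have hj2 : j ∉ q.2 := by
      intro hj2
      have : j ∈ q.2.erase c := Finset.mem_erase.mpr ⟨hjq.1, hj2⟩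
      rw [hqe] at this
      exact Finset.disjoint_left.mp hd hj (Finset.mem_of_mem_erase this)
    have h1 := hβ.2.2 j (by simp [hjq.2, hj2])
    rw [hα.2.1 j hj] at h1
    norm_num at h1
  obtain ⟨γ, hγ, hzγ⟩ := (mem_tileSet_iff hdq).mp hqε
  have hNz : N z = ∑ j ∈ p.1, N (v j) := by
    rw [hz, hα.sum_eq hd, map_add, map_sum, map_sum, add_eq_left]
    refine Finset.sum_eq_zero fun j hj => ?_
    rw [map_smul, smul_eq_mul]
    by_cases hjb : j = b
    · subst hjb
      have : j ∉ p.1 := fun h' => Finset.disjoint_left.mp hd h' hj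
      simp [hαdef, this]
    · rw [hN0 j (Finset.mem_erase.mpr ⟨hjb, hj⟩), mul_zero]
  have hNγ : N (z - ε • v i) = ∑ j ∈ q.1, N (v j) + γ c * N (v c) := by
    rw [hzγ, hγ.sum_eq hdq, map_add, map_sum, map_sum,
      Finset.sum_eq_single_of_mem c hcmem.1, map_smul, smul_eq_mul]
    intro j hj hjc
    have : j ∈ q.2.erase c := Finset.mem_erase.mpr ⟨hjc, hj⟩
    rw [map_smul, hN0 j (hqe ▸ this), smul_zero]
  rw [map_sub, map_smul, smul_eq_mul, hNz] at hNγ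
  have hpos : 0 < ε * N (v i) := mul_pos hε1.1 hNi
  refine ⟨q, hq, c, hcmem.1, hqe, ?_⟩
  have hcq1 : c ∉ q.1 := fun h' => Finset.disjoint_left.mp hdq h' hcmem.1
  by_cases hcp : c ∈ p.1
  · right
    have hpe : p.1 = insert c q.1 :=
      Finset.Subset.antisymm hI2 (Finset.insert_subset hcp hI1)
    refine ⟨hpe, ?_⟩
    rw [hpe, Finset.sum_insert hcq1] at hNγ
    have := hγ.1 c
    nlinarith
  · left
    have hpe : q.1 = p.1 := Finset.Subset.antisymm hI1 fun j hj => by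
      rcases Finset.mem_insert.mp (hI2 hj) with rfl | h'
      · exact absurd hj hcp
      · exact h'
    refine ⟨hpe, ?_⟩
    rw [hpe] at hNγ
    have := hγ.1 c
    by_contra hcon
    nlinarith [mul_nonneg this.1 (not_lt.mp hcon)]

/-- Moving a nonnegative vector `g` along `r` until a coordinate indexed by `B` vanishes. -/
lemma exists_first_vanishing {g r : Fin n → ℝ} {B : Finset (Fin n)} (hg : ∀ i, 0 ≤ g i)
    (hr : ∀ i ∉ B, 0 ≤ r i) (hneg : ∃ b ∈ B, r b < 0) :
    ∃ b ∈ B, r b < 0 ∧ ∃ t : ℝ, (∀ i, 0 ≤ g i + t * r i) ∧ g b + t * r b = 0 := by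
  classical
  obtain ⟨b₀, hb₀, hrb₀⟩ := hneg
  obtain ⟨b, hb, hmin⟩ := Finset.exists_min_image (B.filter fun b => r b < 0)
    (fun b => g b / -r b) ⟨b₀, by simp [hb₀, hrb₀]⟩
  rw [Finset.mem_filter] at hb
  have ht : 0 ≤ g b / -r b := div_nonneg (hg b) (by linarith [hb.2])
  refine ⟨b, hb.1, hb.2, g b / -r b, fun i => ?_, ?_⟩
  · rcases le_or_gt 0 (r i) with hi | hi
    · exact add_nonneg (hg i) (_root_.mul_nonneg ht hi)
    · have hiB : i ∈ B := by
        by_contra hiB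
        linarith [hr i hiB]
      have := hmin i (by simp [hiB, hi])
      rw [le_div_iff₀ (by linarith)] at this
      linarith
  · have := hb.2.ne
    field_simp
    ring

/-- A Carathéodory-type exchange: a point of the hull of `I ⊔ B` with coordinates `c` in the
basis `B` lies in the hull of `I ⊔ B \ {b}` for some `b` with `c b > 0`. -/
lemma exists_exchange {ℓ : E →ₗ[ℝ] ℝ} (hℓ : ∀ i, ℓ (v i) = 1) {I B : Finset (Fin n)}
    (hIB : Disjoint I B) (hI : I.Nonempty) {X : E} {w c : Fin n → ℝ} (hw : ∀ i, 0 ≤ w i)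
    (hwIB : ∀ i ∉ I ∪ B, w i = 0) (hwX : ∑ i, w i • v i = X)
    (hcB : ∀ i ∉ B, c i = 0) (hcX : ∑ i, c i • v i = X)
    (hspan : ∀ i ∈ I, ∃ e : Fin n → ℝ, (∀ j ∉ B, e j = 0) ∧ ∑ j, e j • v j = v i ∧
      ∀ b ∈ B, 0 < e b → c b ≠ 0) :
    ∃ b ∈ B, 0 < c b ∧ ∃ w' : Fin n → ℝ, (∀ i, 0 ≤ w' i) ∧
      (∀ i ∉ I ∪ B.erase b, w' i = 0) ∧ ∑ i, w' i • v i = X := by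
  classical
  have core : ∀ g r : Fin n → ℝ, (∀ i, 0 ≤ g i) → (∀ i ∉ I ∪ B, g i = 0) →
      ∑ i, g i • v i = X → (∀ i ∉ B, 0 ≤ r i) → (∀ i ∉ I ∪ B, r i = 0) →
      ∑ i, r i • v i = 0 → (∃ b ∈ B, r b < 0) → (∀ b ∈ B, r b < 0 → 0 < c b) →
      ∃ b ∈ B, 0 < c b ∧ ∃ w' : Fin n → ℝ, (∀ i, 0 ≤ w' i) ∧
        (∀ i ∉ I ∪ B.erase b, w' i = 0) ∧ ∑ i, w' i • v i = X := by
    intro g r hg hg0 hgX hr hr0 hrX hneg hcpos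
    obtain ⟨b, hb, hrb, t, ht, htb⟩ := exists_first_vanishing hg hr hneg
    refine ⟨b, hb, hcpos b hb hrb, fun i => g i + t * r i, ht, fun i hi => ?_, ?_⟩
    · by_cases hib : i = b
      · rw [hib]; exact htb
      · have hi' : i ∉ I ∪ B := by
          simp only [Finset.mem_union, Finset.mem_erase, not_or] at hi ⊢
          tauto
        simp [hg0 i hi', hr0 i hi']
    · simp only [add_smul, mul_smul, Finset.sum_add_distrib, ← Finset.smul_sum, hrX, hgX,
        smul_zero, add_zero]
  by_cases hcase : ∃ b ∈ B, w b < c b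
  · refine core w (fun i => w i - c i) hw hwIB hwX (fun i hi => ?_) (fun i hi => ?_) ?_ ?_ ?_
    · rw [hcB i hi, sub_zero]; exact hw i
    · rw [hwIB i hi, hcB i fun h' => hi (Finset.mem_union_right _ h'), sub_zero]
    · simp [sub_smul, Finset.sum_sub_distrib, hwX, hcX]
    · obtain ⟨b, hb, hbc⟩ := hcase
      exact ⟨b, hb, by linarith⟩
    · intro b _ hbc
      linarith [hw b]
  · push Not at hcase
    have hle : ∀ i, 0 ≤ w i - c i := fun i => by
      by_cases hi : i ∈ B
      · linarith [hcase i hi]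
      · rw [hcB i hi, sub_zero]; exact hw i
    have hsum : ∑ i, (w i - c i) = 0 := by
      have := congrArg ℓ (hwX.trans hcX.symm)
      simp only [map_sum, map_smul, hℓ, smul_eq_mul, mul_one] at this
      rw [Finset.sum_sub_distrib, this, sub_self]
    have hwc : ∀ i, w i = c i := fun i => sub_eq_zero.mp
      ((Finset.sum_eq_zero_iff_of_nonneg fun i _ => hle i).mp hsum i (Finset.mem_univ i))
    obtain ⟨i, hi⟩ := hI
    obtain ⟨e, heB, hei, hec⟩ := hspan i hi
    have hiB : i ∉ B := Finset.disjoint_left.mp hIB hi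
    refine core w (fun j => (if j = i then 1 else 0) - e j) hw hwIB hwX (fun j hj => ?_)
      (fun j hj => ?_) ?_ ?_ ?_
    · rw [heB j hj]; split_ifs <;> norm_num
    · rw [Finset.mem_union, not_or] at hj
      have : j ≠ i := fun h' => hj.1 (h' ▸ hi)
      simp [this, heB j hj.2]
    · simp [sub_smul, Finset.sum_sub_distrib, hei]
    · have he1 : ∑ j, e j = 1 := by
        have := congrArg ℓ hei
        simpa only [map_sum, map_smul, hℓ, smul_eq_mul, mul_one] using this
      obtain ⟨b, -, hb⟩ := Finset.exists_lt_of_sum_lt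
        (s := Finset.univ) (f := fun _ : Fin n => (0 : ℝ)) (g := e) (by simp [he1])
      have hbB : b ∈ B := by
        by_contra hbB
        exact hb.ne' (heB b hbB)
      have hbi : b ≠ i := fun h' => hiB (h' ▸ hbB)
      exact ⟨b, hbB, by simpa [hbi] using hb⟩
    · intro b hb hbr
      have hbi : b ≠ i := fun h' => hiB (h' ▸ hb)
      simp only [if_neg hbi, zero_sub, neg_lt_zero] at hbr
      exact lt_of_le_of_ne (hwc b ▸ hw b) (hec b hb hbr).symm

end Tiles

lemma sum_smul_snoc_one_eq_iff {n d : ℕ} {a : Fin n → (Fin d → ℝ)} {x : Fin d → ℝ}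
    {w : Fin n → ℝ} :
    ∑ i, w i • (Fin.snoc (a i) 1 : Fin (d + 1) → ℝ) = Fin.snoc x 1 ↔
      ∑ i, w i • a i = x ∧ ∑ i, w i = 1 := by
  rw [funext_iff, Fin.forall_fin_succ', funext_iff]
  simp [Finset.sum_apply]

/-- Convex hull membership in terms of the lifted points `(a i, 1)`. -/
lemma mem_convexHull_image_iff_lift {n d : ℕ} (a : Fin n → (Fin d → ℝ)) (S : Finset (Fin n))
    (x : Fin d → ℝ) :
    x ∈ convexHull ℝ (a '' ↑S) ↔ ∃ w : Fin n → ℝ, (∀ i, 0 ≤ w i) ∧ (∀ i ∉ S, w i = 0) ∧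
      ∑ i, w i • (Fin.snoc (a i) 1 : Fin (d + 1) → ℝ) = Fin.snoc x 1 := by
  simp only [sum_smul_snoc_one_eq_iff]
  constructor
  · intro hx
    refine convexHull_min (t := {x | ∃ w : Fin n → ℝ, (∀ i, 0 ≤ w i) ∧ (∀ i ∉ S, w i = 0) ∧
      ∑ i, w i • a i = x ∧ ∑ i, w i = 1}) ?_ ?_ hx
    · rintro _ ⟨i, hi, rfl⟩
      refine ⟨Pi.single i 1, fun j => ?_, fun j hj => ?_, ?_, ?_⟩
      · by_cases hj : j = i
        · subst hj; simp
        · simp [hj]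
      · have : j ≠ i := fun h' => hj (h' ▸ hi)
        simp [this]
      · simp [Pi.single_apply, ite_smul]
      · simp
    · rintro _ ⟨w, hw, hwS, rfl, hw1⟩ _ ⟨u, hu, huS, rfl, hu1⟩ s t hs ht hst
      refine ⟨fun i => s * w i + t * u i, fun i => ?_, fun i hi => ?_, ?_, ?_⟩
      · exact add_nonneg (mul_nonneg hs (hw i)) (mul_nonneg ht (hu i))
      · simp [hwS i hi, huS i hi]
      · simp [add_smul, mul_smul, Finset.sum_add_distrib, Finset.smul_sum]
      · rw [Finset.sum_add_distrib, ← Finset.mul_sum, ← Finset.mul_sum, hw1, hu1, mul_one,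
          mul_one, hst]
  · rintro ⟨w, hw, hwS, rfl, hw1⟩
    rw [← Finset.sum_subset (Finset.subset_univ S) fun i _ hi => by rw [hwS i hi, zero_smul]]
    rw [← Finset.sum_subset (Finset.subset_univ S) fun i _ hi => hwS i hi] at hw1
    exact (convex_convexHull ℝ _).sum_mem (fun i _ => hw i) hw1 fun i hi =>
      subset_convexHull ℝ _ ⟨i, hi, rfl⟩

/-- A linear relation among lifted points expresses affine span membership. -/
lemma mem_affineSpan_image_of_lift {n d : ℕ} (a : Fin n → (Fin d → ℝ)) (S : Finset (Fin n))
    (x : Fin d → ℝ) {c : Fin n → ℝ} (hc : ∀ i ∉ S, c i = 0)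
    (hX : ∑ i, c i • (Fin.snoc (a i) 1 : Fin (d + 1) → ℝ) = Fin.snoc x 1) :
    x ∈ affineSpan ℝ (a '' ↑S) := by
  obtain ⟨rfl, h1⟩ := sum_smul_snoc_one_eq_iff.mp hX
  rw [← Finset.sum_subset (Finset.subset_univ S) fun i _ hi => by rw [hc i hi, zero_smul],
    ← Finset.sum_coe_sort S fun i => c i • a i]
  rw [← Finset.sum_subset (Finset.subset_univ S) fun i _ hi => hc i hi,
    ← Finset.sum_coe_sort S] at h1
  rw [← Finset.affineCombination_eq_linear_combination _ (fun i : S => a i) _ h1]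
  convert affineCombination_mem_affineSpan h1 fun i : S => a i
  ext
  simp

/-- The normal vector of a lower facet of the lifted arrangement gives a tile functional. -/
lemma exists_isTileFunctional {n d : ℕ} (a : Fin n → (Fin d → ℝ)) (h : Fin n → ℝ)
    (p : Finset (Fin n) × Finset (Fin n)) (y : Fin (d + 2) → ℝ) (hy : 0 < y (Fin.last d).castSucc)
    (hyp : ∀ i : Fin n,
      (i ∈ p.1 →
        0 < ∑ j, y j * (Fin.snoc (Fin.snoc (a i) (h i)) 1 : Fin (d + 2) → ℝ) j) ∧
      (i ∈ p.2 →
        ∑ j, y j * (Fin.snoc (Fin.snoc (a i) (h i)) 1 : Fin (d + 2) → ℝ) j = 0) ∧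
      (i ∉ p.1 ∪ p.2 →
        ∑ j, y j * (Fin.snoc (Fin.snoc (a i) (h i)) 1 : Fin (d + 2) → ℝ) j < 0)) :
    ∃ L : (Fin (d + 1) → ℝ) →ₗ[ℝ] ℝ,
      IsTileFunctional (fun i => (Fin.snoc (a i) 1 : Fin (d + 1) → ℝ)) h p L := by
  set t := y (Fin.last d).castSucc with ht
  let u : Fin (d + 1) → ℝ := Fin.snoc (fun j : Fin d => y j.castSucc.castSucc) (y (Fin.last _))
  let L : (Fin (d + 1) → ℝ) →ₗ[ℝ] ℝ := (-t⁻¹) • ∑ j, u j • LinearMap.proj j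
  have key : ∀ i, ∑ j, y j * (Fin.snoc (Fin.snoc (a i) (h i)) 1 : Fin (d + 2) → ℝ) j
      = t * (h i - L (Fin.snoc (a i) 1 : Fin (d + 1) → ℝ)) := by
    intro i
    simp only [Fin.sum_univ_castSucc, Fin.snoc_castSucc, Fin.snoc_last, L, u, ← ht,
      LinearMap.smul_apply, LinearMap.add_apply, LinearMap.sum_apply, LinearMap.proj_apply,
      smul_eq_mul]
    field_simp
    ring
  simp only [key] at hyp
  refine ⟨L, fun i hi => ?_, fun i hi => ?_, fun i hi => ?_⟩
  · linarith [(mul_pos_iff_of_pos_left hy).mp ((hyp i).1 hi)]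
  · linarith [(mul_eq_zero_iff_left hy.ne').mp ((hyp i).2.1 hi)]
  · linarith [neg_of_mul_neg_right ((hyp i).2.2 hi) hy.le]

/-- Predecessor of a supported tile of positive order: it is supported, has no larger order,
and its functional takes a larger value at the lift of `x`. -/
lemma exists_supported_predecessor {n d : ℕ} {a : Fin n → (Fin d → ℝ)} {h : Fin n → ℝ}
    {P : Finset (Finset (Fin n) × Finset (Fin n))}
    (hP : IsFineZonotopalTiling d (fun i => (Fin.snoc (a i) 1 : Fin (d + 1) → ℝ)) P)
    {L : Finset (Fin n) × Finset (Fin n) → (Fin (d + 1) → ℝ) →ₗ[ℝ] ℝ}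
    (hL : ∀ p ∈ P, IsTileFunctional (fun i => (Fin.snoc (a i) 1 : Fin (d + 1) → ℝ)) h p (L p))
    {x : Fin d → ℝ}
    (hx : ∀ p ∈ P, ∀ b ∈ p.2,
      (∃ q ∈ P, q ≠ p ∧ ∃ b' ∈ q.2, p.2.erase b = q.2.erase b') →
      x ∉ (affineSpan ℝ (a '' ↑(p.2.erase b)) : Set (Fin d → ℝ)))
    {p : Finset (Fin n) × Finset (Fin n)} (hp : p ∈ P) (hI : p.1.Nonempty)
    (hpx : x ∈ convexHull ℝ (a '' ↑(p.1 ∪ p.2))) :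
    ∃ q ∈ P, stepRel a P x q p ∧ x ∈ convexHull ℝ (a '' ↑(q.1 ∪ q.2)) ∧
      q.1.card ≤ p.1.card ∧
      L p (Fin.snoc x 1 : Fin (d + 1) → ℝ) < L q (Fin.snoc x 1 : Fin (d + 1) → ℝ) := by
  classical
  set v : Fin n → Fin (d + 1) → ℝ := fun i => Fin.snoc (a i) 1 with hv
  set X : Fin (d + 1) → ℝ := Fin.snoc x 1 with hX
  have hd := hP.disj p hp
  have hnb : Nonempty p.2 := by
    rw [Finset.nonempty_coe_sort, ← Finset.card_pos, hP.cardB p hp]; omega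
  let bs := basisOfLinearIndependentOfCardEqFinrank (hP.indep p hp)
    (by rw [Fintype.card_coe, hP.cardB p hp, Module.finrank_fin_fun])
  have hbs : ∀ b : p.2, bs b = v b := fun b => by simp [bs, hv]
  -- coordinates in the basis, extended by zero
  let co : (Fin (d + 1) → ℝ) → Fin n → ℝ := fun z i =>
    if hi : i ∈ p.2 then bs.coord ⟨i, hi⟩ z else 0
  have hco0 : ∀ z, ∀ i ∉ p.2, co z i = 0 := fun z i hi => dif_neg hi
  have hcosum : ∀ z, ∑ i, co z i • v i = z := by
    intro z
    rw [← Finset.sum_subset (Finset.subset_univ p.2)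
      fun i _ hi => by rw [hco0 z i hi, zero_smul], ← Finset.sum_coe_sort]
    conv_rhs => rw [← bs.sum_repr z]
    refine Finset.sum_congr rfl fun b _ => ?_
    simp [co, hbs]
  have hNv : ∀ b (hb : b ∈ p.2), ∀ c ∈ p.2.erase b, bs.coord ⟨b, hb⟩ (v c) = 0 := by
    intro b hb c hc
    have hc' := Finset.mem_of_mem_erase hc
    have hne : (⟨c, hc'⟩ : p.2) ≠ ⟨b, hb⟩ := fun h' =>
      Finset.ne_of_mem_erase hc (congrArg Subtype.val h')
    rw [← hbs ⟨c, hc'⟩, Module.Basis.coord_apply, Module.Basis.repr_self,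
      Finsupp.single_eq_of_ne hne.symm]
  have hNb : ∀ b (hb : b ∈ p.2), bs.coord ⟨b, hb⟩ (v b) = 1 := by
    intro b hb
    rw [← hbs ⟨b, hb⟩, Module.Basis.coord_apply, Module.Basis.repr_self,
      Finsupp.single_eq_same]
  have hadj : ∀ b (hb : b ∈ p.2), ∀ i ∈ p.1, 0 < bs.coord ⟨b, hb⟩ (v i) →
      ∃ q ∈ P, ∃ c ∈ q.2, q.2.erase c = p.2.erase b ∧
        ((q.1 = p.1 ∧ bs.coord ⟨b, hb⟩ (v c) < 0) ∨
          (p.1 = insert c q.1 ∧ 0 < bs.coord ⟨b, hb⟩ (v c))) :=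
    fun b hb i hi hpos => exists_adjacent_tile hP (fun q hq => ⟨_, hL q hq⟩) hp hb
      (hNv b hb) hi hpos
  have hqne : ∀ b (hb : b ∈ p.2), ∀ q ∈ P, ∀ c ∈ q.2, q.2.erase c = p.2.erase b →
      ((q.1 = p.1 ∧ bs.coord ⟨b, hb⟩ (v c) < 0) ∨
          (p.1 = insert c q.1 ∧ 0 < bs.coord ⟨b, hb⟩ (v c))) → q ≠ p := by
    rintro b hb q hq c hc hqe hcase rfl
    rcases hcase with ⟨-, hneg⟩ | ⟨hins, -⟩
    · by_cases hcb : c = b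
      · subst hcb
        rw [hNb c hc] at hneg
        linarith
      · rw [hNv b hb c (Finset.mem_erase.mpr ⟨hcb, hc⟩)] at hneg
        exact lt_irrefl _ hneg
    · have : c ∈ q.1 := by rw [hins]; exact Finset.mem_insert_self _ _
      exact Finset.disjoint_left.mp hd this hc
  have hℓ : ∀ i, (LinearMap.proj (Fin.last d) : (Fin (d + 1) → ℝ) →ₗ[ℝ] ℝ) (v i) = 1 :=
    fun i => by simp [hv]
  obtain ⟨w, hw, hw0, hwX⟩ := (mem_convexHull_image_iff_lift a _ x).mp hpx
  obtain ⟨b, hb, hcb, w', hw', hw'0, hw'X⟩ := exists_exchange hℓ hd hI hw hw0 hwX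
    (hco0 X) (hcosum X) fun i hi => by
      refine ⟨co (v i), hco0 _, hcosum _, fun b hb hpos hzero => ?_⟩
      simp only [co, dif_pos hb] at hpos
      obtain ⟨q, hq, c, hc, hqe, hcase⟩ := hadj b hb i hi hpos
      refine hx p hp b hb ⟨q, hq, hqne b hb q hq c hc hqe hcase, c, hc, hqe.symm⟩ ?_
      refine mem_affineSpan_image_of_lift a _ x (c := co X) (fun j hj => ?_) (hcosum X)
      by_cases hjb : j = b
      · rw [hjb]; exact hzero
      · exact hco0 X j fun hj' => hj (Finset.mem_erase.mpr ⟨hjb, hj'⟩)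
  set N := bs.coord ⟨b, hb⟩ with hN
  have hNX : 0 < N X := by simpa only [co, dif_pos hb] using hcb
  obtain ⟨i, hi, hNi⟩ : ∃ i ∈ p.1, 0 < N (v i) := by
    by_contra hcon
    push Not at hcon
    have hle : N X ≤ 0 := by
      rw [hX, ← hw'X, map_sum]
      refine Finset.sum_nonpos fun i _ => ?_
      rw [map_smul, smul_eq_mul]
      by_cases hi : i ∈ p.1
      · exact mul_nonpos_of_nonneg_of_nonpos (hw' i) (hcon i hi)
      by_cases hi2 : i ∈ p.2.erase b
      · exact (mul_eq_zero_of_right _ (hNv b hb i hi2)).le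
      · rw [hw'0 i (by simp only [Finset.mem_union, not_or]; exact ⟨hi, hi2⟩), zero_mul]
    linarith
  obtain ⟨q, hq, c, hc, hqe, hcase⟩ := hadj b hb i hi hNi
  have hqp := hqne b hb q hq c hc hqe hcase
  have hdq := hP.disj q hq
  have hcq1 : c ∉ q.1 := fun h' => Finset.disjoint_left.mp hdq h' hc
  have hcC : c ∉ p.2.erase b := hqe ▸ Finset.notMem_erase c q.2
  refine ⟨q, hq, ⟨hq, hp, hqp, c, hc, b, hb, hqe, ?_, fun j => N (Pi.single j 1), ?_⟩, ?_, ?_, ?_⟩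
  · rcases hcase with ⟨h1, -⟩ | ⟨h1, -⟩
    · exact Or.inl h1
    · exact Or.inr (Or.inr (Or.inl h1))
  · have hNz : ∀ z : Fin (d + 1) → ℝ, ∑ j, N (Pi.single j 1) * z j = N z := by
      intro z
      conv_rhs => rw [← Finset.univ_sum_single z, map_sum]
      refine Finset.sum_congr rfl fun j _ => ?_
      rw [mul_comm, ← smul_eq_mul, ← map_smul, ← Pi.single_smul, smul_eq_mul, mul_one]
    refine ⟨fun h0 => ?_, fun e he => ?_, ?_, fun z hz z' hz' => ?_⟩
    · have := hNz X
      simp only [funext_iff, Pi.zero_apply] at h0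
      simp only [h0, zero_mul, Finset.sum_const_zero] at this
      linarith
    · rw [hNz]; exact hNv b hb e (hqe ▸ he)
    · rw [hNz]; exact hNX
    · have := hNz (z' - z)
      simp only [Pi.sub_apply] at this
      rw [this, map_sub]
      obtain ⟨α, hα, rfl⟩ := hz
      obtain ⟨β, hβ, rfl⟩ := hz'
      have hsum : ∀ (B : Finset (Fin n)) (e : Fin n) (γ : Fin n → ℝ), e ∈ B →
          (∀ j ∈ B.erase e, N (v j) = 0) → N (∑ j ∈ B, γ j • v j) = γ e * N (v e) := by
        intro B e γ he hB
        rw [map_sum, Finset.sum_eq_single_of_mem e he, map_smul, smul_eq_mul]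
        intro j hj hje
        rw [map_smul, hB j (Finset.mem_erase.mpr ⟨hje, hj⟩), smul_zero]
      rw [map_add, map_add, hsum p.2 b β hb (hNv b hb),
        hsum q.2 c α hc (fun j hj => hNv b hb j (hqe ▸ hj)), hNb b hb, mul_one]
      have hβb := (hβ b hb).1
      have hαc := hα c hc
      rcases hcase with ⟨h1, h2⟩ | ⟨h1, h2⟩
      · rw [h1]
        nlinarith [hαc.1]
      · rw [h1, Finset.sum_insert hcq1, map_add]
        nlinarith [hαc.2]
  · refine (mem_convexHull_image_iff_lift a _ x).mpr ⟨w', hw', fun j hj => hw'0 j ?_, hw'X⟩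
    intro hj'
    refine hj ?_
    rcases Finset.mem_union.mp hj' with hj1 | hj2
    · rcases hcase with ⟨h1, -⟩ | ⟨h1, -⟩
      · exact Finset.mem_union_left _ (h1 ▸ hj1)
      · rw [h1] at hj1
        rcases Finset.mem_insert.mp hj1 with rfl | hj1
        · exact Finset.mem_union_right _ hc
        · exact Finset.mem_union_left _ hj1
    · rw [← hqe] at hj2
      exact Finset.mem_union_right _ (Finset.mem_of_mem_erase hj2)
  · refine Finset.card_le_card ?_
    rcases hcase with ⟨h1, -⟩ | ⟨h1, -⟩
    · exact h1.subset
    · rw [h1]; exact Finset.subset_insert _ _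
  · set D := L q - L p with hD
    have hDC : ∀ e ∈ p.2.erase b, D (v e) = 0 := by
      intro e he
      rw [hD, LinearMap.sub_apply, (hL p hp).2.1 e (Finset.mem_of_mem_erase he),
        (hL q hq).2.1 e (Finset.mem_of_mem_erase (hqe ▸ he)), sub_self]
    have hDN : D = D (v b) • N := by
      refine bs.ext fun e => ?_
      rw [hbs, LinearMap.smul_apply, smul_eq_mul]
      by_cases heb : (e : Fin n) = b
      · rw [heb, hNb b hb, mul_one]
      · have he := Finset.mem_erase.mpr ⟨heb, e.2⟩
        rw [hDC _ he, hNv b hb _ he, mul_zero]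
    have hDc := congrArg (fun F => F (v c)) hDN
    have hDX := congrArg (fun F => F X) hDN
    simp only [LinearMap.smul_apply, smul_eq_mul] at hDc hDX
    have hqc := (hL q hq).2.1 c hc
    have ht : 0 < D (v b) := by
      have hDc' : D (v c) = h c - L p (v c) := by rw [hD, LinearMap.sub_apply, hqc]
      rcases hcase with ⟨h1, h2⟩ | ⟨h1, h2⟩
      · have hcp2 : c ∉ p.2 := fun h' => by
          by_cases hcb' : c = b
          · rw [hcb', hNb b hb] at h2; linarith
          · exact hcC (Finset.mem_erase.mpr ⟨hcb', h'⟩)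
        have := (hL p hp).2.2 c (by simp [hcp2, ← h1, hcq1])
        nlinarith
      · have := (hL p hp).1 c (h1 ▸ Finset.mem_insert_self _ _)
        nlinarith
    have := mul_pos ht hNX
    rw [← hDX, hD, LinearMap.sub_apply] at this
    linarith

/-- **Reachability of supported tiles.**  For a regular fine zonotopal tiling `P(h)`
induced by a generic height function `h`, a generic point `x ∈ conv(A)`, and the unique
order-zero tile `Π_{∅,Z}` supported on `x`, every tile `Π_{I',B'}` supported on `x` is
reachable from `Π_{∅,Z}` by a directed path in `(G, o_x)` all of whose tiles `Π_{I,B}`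
are supported on `x` and satisfy `|I| ≤ |I'|`. -/
theorem supported_tiles_reachable (n d : ℕ) (a : Fin n → (Fin d → ℝ))
    (h : Fin n → ℝ)
    (hgen : ∀ T : Finset (Fin n), T.card = d + 2 →
      ¬ AffineIndependent ℝ (fun i : T => (Fin.snoc (a ↑i) (h ↑i) : Fin (d + 1) → ℝ)) →
      ∃ N : Fin (d + 1) → ℝ, N ≠ 0 ∧ N ⟨d, by omega⟩ = 0 ∧ ∃ c : ℝ,
        ∀ i ∈ T, ∑ j, N j * (Fin.snoc (a i) (h i) : Fin (d + 1) → ℝ) j = c)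
    (P : Finset (Finset (Fin n) × Finset (Fin n)))
    (hP : IsFineZonotopalTiling d (fun i => (Fin.snoc (a i) 1 : Fin (d + 1) → ℝ)) P)
    (hreg : ∀ p ∈ P, ∃ y : Fin (d + 2) → ℝ, 0 < y ⟨d, by omega⟩ ∧
      ∀ i : Fin n,
        (i ∈ p.1 →
          0 < ∑ j, y j * (Fin.snoc (Fin.snoc (a i) (h i)) 1 : Fin (d + 2) → ℝ) j) ∧
        (i ∈ p.2 →
          ∑ j, y j * (Fin.snoc (Fin.snoc (a i) (h i)) 1 : Fin (d + 2) → ℝ) j = 0) ∧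
        (i ∉ p.1 ∪ p.2 →
          ∑ j, y j * (Fin.snoc (Fin.snoc (a i) (h i)) 1 : Fin (d + 2) → ℝ) j < 0))
    (x : Fin d → ℝ) (hxA : x ∈ convexHull ℝ (Set.range a))
    (hx : ∀ p ∈ P, ∀ b ∈ p.2,
      (∃ q ∈ P, q ≠ p ∧ ∃ b' ∈ q.2, p.2.erase b = q.2.erase b') →
      x ∉ (affineSpan ℝ (a '' ↑(p.2.erase b)) : Set (Fin d → ℝ)))
    (p0 : Finset (Fin n) × Finset (Fin n)) (hp0 : p0 ∈ P) (hp0I : p0.1 = ∅)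
    (hp0x : x ∈ convexHull ℝ (a '' ↑p0.2))
    (hp0uniq : ∀ q ∈ P, q.1 = ∅ → x ∈ convexHull ℝ (a '' ↑q.2) → q = p0)
    (p' : Finset (Fin n) × Finset (Fin n)) (hp' : p' ∈ P)
    (hp'x : x ∈ convexHull ℝ (a '' ↑(p'.1 ∪ p'.2))) :
    Relation.ReflTransGen
      (fun p q => stepRel a P x p q ∧
        x ∈ convexHull ℝ (a '' ↑(q.1 ∪ q.2)) ∧ q.1.card ≤ p'.1.card)
      p0 p' := by
  classical
  choose! L hL using fun p (hp : p ∈ P) =>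
    let ⟨y, hy, hyp⟩ := hreg p hp
    exists_isTileFunctional a h p y hy hyp
  by_contra hbad
  obtain ⟨p, hpS, hmax⟩ := Finset.exists_max_image
    (P.filter fun p : Finset (Fin n) × Finset (Fin n) =>
      x ∈ convexHull ℝ (a '' ↑(p.1 ∪ p.2)) ∧ p.1.card ≤ p'.1.card ∧
      ¬ Relation.ReflTransGen (fun p q => stepRel a P x p q ∧
        x ∈ convexHull ℝ (a '' ↑(q.1 ∪ q.2)) ∧ q.1.card ≤ p'.1.card) p0 p)
    (fun p => L p (Fin.snoc x 1 : Fin (d + 1) → ℝ))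
    ⟨p', Finset.mem_filter.mpr ⟨hp', hp'x, le_rfl, hbad⟩⟩
  obtain ⟨hp, hpx, hcard, hpbad⟩ := Finset.mem_filter.mp hpS
  rcases p.1.eq_empty_or_nonempty with hI | hI
  · rw [hI, Finset.empty_union] at hpx
    exact hpbad (hp0uniq p hp hI hpx ▸ Relation.ReflTransGen.refl)
  · obtain ⟨q, hq, hstep, hqx, hqcard, hlt⟩ := exists_supported_predecessor hP hL hx hp hI hpx
    by_cases hgood : Relation.ReflTransGen (fun p q => stepRel a P x p q ∧
        x ∈ convexHull ℝ (a '' ↑(q.1 ∪ q.2)) ∧ q.1.card ≤ p'.1.card) p0 q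
    · exact hpbad (hgood.tail ⟨hstep, hpx, hcard⟩)
    · exact absurd (hmax q (Finset.mem_filter.mpr ⟨hq, hqx, hqcard.trans hcard, hgood⟩))
        (not_le.mpr hlt)
end
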